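/- Let n ≥ 1, E ⊂ ℝⁿ a measurable set, and Ω a bounded open set with Lipschitz boundary, compactly contained in ℝⁿ. Then for every sequence s_i → (1/2)⁻ there exists a sequence of measurable sets E_i ⊂ ℝⁿ with χ_{E_i} → χ_E in L¹_loc(ℝⁿ) such that limsup_{i→∞} (1/2 − s_i) Per_{s_i}(E_i,Ω) ≤ ω_{n−1} Per(E,Ω), where ω_{n−1} is the Lebesgue measure of the unit ball of ℝ^{n−1}. -/

import Mathlib

open MeasureTheory Filter Topology Metric Set
open scoped ENNReal NNReal RealInnerProductSpace

noncomputable section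

/-- `ℝⁿ` with the Euclidean structure. -/
abbrev Rn (n : ℕ) := EuclideanSpace ℝ (Fin n)

/-- A double-well potential with wells at `±1`. -/
def DoubleWell (W : ℝ → ℝ) : Prop :=
  ContDiff ℝ 2 W ∧ (∀ t, 0 ≤ W t) ∧ W 1 = 0 ∧ W (-1) = 0 ∧
    (∀ t, t ≠ 1 → t ≠ -1 → 0 < W t) ∧
    deriv W 1 = 0 ∧ deriv W (-1) = 0 ∧
    0 < iteratedDeriv 2 W 1 ∧ 0 < iteratedDeriv 2 W (-1)

/-- Membership in `X = {u ∈ L^∞(ℝⁿ) : ‖u‖_∞ ≤ 1}`. -/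
def memX (n : ℕ) (u : Rn n → ℝ) : Prop :=
  Measurable u ∧ ∀ᵐ x ∂(volume : Measure (Rn n)), |u x| ≤ 1

/-- Convergence `u_ε → u₀` in `L¹_loc(ℝⁿ)` as `ε → 0⁺`. -/
def TendstoL1loc (n : ℕ) (u : ℝ → Rn n → ℝ) (u₀ : Rn n → ℝ) : Prop :=
  ∀ K : Set (Rn n), IsCompact K →
    Tendsto (fun ε => ∫⁻ x in K, ENNReal.ofReal |u ε x - u₀ x| ∂volume)
      (𝓝[>] (0:ℝ)) (𝓝 0)

/-- Interior interaction kernel `K^int(u,Ω)`. -/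
def Kint (n : ℕ) (s : ℝ) (u : Rn n → ℝ) (Ω : Set (Rn n)) : ℝ≥0∞ :=
  ∫⁻ x in Ω, ∫⁻ y in Ω, ENNReal.ofReal (|u x - u y| ^ 2 / ‖x - y‖ ^ ((n : ℝ) + 2 * s))

/-- Exterior interaction kernel `K^ext(u,Ω)`. -/
def Kext (n : ℕ) (s : ℝ) (u : Rn n → ℝ) (Ω : Set (Rn n)) : ℝ≥0∞ :=
  2 * ∫⁻ x in Ω, ∫⁻ y in Ωᶜ, ENNReal.ofReal (|u x - u y| ^ 2 / ‖x - y‖ ^ ((n : ℝ) + 2 * s))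

/-- Potential term `∫_Ω W(u)`. -/
def PotTerm (n : ℕ) (W : ℝ → ℝ) (u : Rn n → ℝ) (Ω : Set (Rn n)) : ℝ≥0∞ :=
  ∫⁻ x in Ω, ENNReal.ofReal (W (u x))

/-- `F^int_ε` for `s ∈ (0,1/2)`. -/
def Fint (n : ℕ) (s : ℝ) (W : ℝ → ℝ) (ε : ℝ) (u : Rn n → ℝ) (Ω : Set (Rn n)) : ℝ≥0∞ :=
  Kint n s u Ω + ENNReal.ofReal (ε ^ (-(2 * s)) / 2) * PotTerm n W u Ω

/-- `F^ext_ε` for `s ∈ (0,1/2)`. -/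
def Fext (n : ℕ) (s : ℝ) (W : ℝ → ℝ) (ε : ℝ) (u : Rn n → ℝ) (Ω : Set (Rn n)) : ℝ≥0∞ :=
  Kext n s u Ω + ENNReal.ofReal (ε ^ (-(2 * s)) / 2) * PotTerm n W u Ω

/-- Interaction functional `I_s(A,B)` between disjoint sets. -/
def Is (n : ℕ) (s : ℝ) (A B : Set (Rn n)) : ℝ≥0∞ :=
  ∫⁻ x in A, ∫⁻ y in B, ENNReal.ofReal (‖x - y‖ ^ (-((n : ℝ) + 2 * s)))

/-- Interior contribution of the fractional perimeter. -/
def PerSInt (n : ℕ) (s : ℝ) (E Ω : Set (Rn n)) : ℝ≥0∞ := Is n s (E ∩ Ω) (Ω \ E)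

/-- Exterior contribution of the fractional perimeter. -/
def PerSExt (n : ℕ) (s : ℝ) (E Ω : Set (Rn n)) : ℝ≥0∞ :=
  Is n s (E \ Ω) (Ω \ E) + Is n s (E ∩ Ω) (Ωᶜ \ E)

/-- Full fractional perimeter. -/
def PerS (n : ℕ) (s : ℝ) (E Ω : Set (Rn n)) : ℝ≥0∞ := PerSInt n s E Ω + PerSExt n s E Ω

/-- `u = χ_E − χ_{ℝⁿ∖E}` a.e. in `Ω`. -/
def phaseIn (n : ℕ) (u : Rn n → ℝ) (Ω E : Set (Rn n)) : Prop :=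
  ∀ᵐ x ∂(volume.restrict Ω), (x ∈ E → u x = 1) ∧ (x ∉ E → u x = -1)

/-- Γ-convergence, as `ε → 0⁺`, in the space `X` with the `L¹_loc` topology. -/
def GammaConvergesX (n : ℕ) (Fε : ℝ → (Rn n → ℝ) → ℝ≥0∞) (F : (Rn n → ℝ) → ℝ≥0∞) : Prop :=
  (∀ u : Rn n → ℝ, memX n u → ∀ uε : ℝ → Rn n → ℝ,
      (∀ ε ∈ Ioi (0:ℝ), memX n (uε ε)) → TendstoL1loc n uε u →
      F u ≤ liminf (fun ε => Fε ε (uε ε)) (𝓝[>] (0:ℝ))) ∧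
  (∀ u : Rn n → ℝ, memX n u → ∃ uε : ℝ → Rn n → ℝ,
      (∀ ε ∈ Ioi (0:ℝ), memX n (uε ε)) ∧ TendstoL1loc n uε u ∧
      limsup (fun ε => Fε ε (uε ε)) (𝓝[>] (0:ℝ)) ≤ F u)

/-- Divergence of a vector field on `ℝⁿ`. -/
def divg (n : ℕ) (φ : Rn n → Rn n) (x : Rn n) : ℝ :=
  ∑ i : Fin n, fderiv ℝ φ x (EuclideanSpace.single i (1:ℝ)) i

/-- Classical (distributional/De Giorgi) perimeter of `E` in the open set `Ω`:
the total variation of the distributional gradient of `χ_E` in `Ω`. -/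
def Per (n : ℕ) (E Ω : Set (Rn n)) : ℝ≥0∞ :=
  ⨆ (φ : Rn n → Rn n) (_ : ContDiff ℝ 1 φ) (_ : HasCompactSupport φ)
    (_ : tsupport φ ⊆ Ω) (_ : ∀ x, ‖φ x‖ ≤ 1),
    ENNReal.ofReal (∫ x in E, divg n φ x)

/-- `Ω` has Lipschitz boundary: near every boundary point, `Ω` is the subgraph
of a Lipschitz function in some direction. -/
def HasLipschitzBoundary (n : ℕ) (Ω : Set (Rn n)) : Prop :=
  ∀ x ∈ frontier Ω, ∃ r > (0:ℝ), ∃ v : Rn n, ‖v‖ = 1 ∧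
    ∃ (L : ℝ≥0) (f : Rn n → ℝ), LipschitzWith L f ∧
      Ω ∩ ball x r = {y ∈ ball x r | ⟪y, v⟫ < f (y - ⟪y, v⟫ • v)}

/-- The reduced boundary `∂*E` (identified, as usual up to an `H^{n-1}`-negligible set,
with the measure-theoretic boundary: points where the density of `E` is neither 0 nor 1). -/
def reducedBoundary (n : ℕ) (E : Set (Rn n)) : Set (Rn n) :=
  {x : Rn n |
    ¬ Tendsto (fun r : ℝ => volume (E ∩ ball x r) / volume (ball x r)) (𝓝[>] 0) (𝓝 0) ∧
    ¬ Tendsto (fun r : ℝ => volume (E ∩ ball x r) / volume (ball x r)) (𝓝[>] 0) (𝓝 1)}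

/-- `ω_m`: Lebesgue measure of the unit ball of `ℝ^m`. -/
def omegaBall (m : ℕ) : ℝ≥0∞ := volume (ball (0 : EuclideanSpace ℝ (Fin m)) 1)

/-- Dirichlet energy `∫_Ω |∇u|²`. -/
def Dirichlet (n : ℕ) (u : Rn n → ℝ) (Ω : Set (Rn n)) : ℝ≥0∞ :=
  ∫⁻ x in Ω, ENNReal.ofReal (‖gradient u x‖ ^ 2)

/-- Allen–Cahn energy `F₁(u,Ω) = ∫_Ω |∇u|² + ∫_Ω W(u)`. -/
def AC (n : ℕ) (W : ℝ → ℝ) (u : Rn n → ℝ) (Ω : Set (Rn n)) : ℝ≥0∞ :=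
  Dirichlet n u Ω + PotTerm n W u Ω

/-- Full nonlocal kernel `K(u,Ω) = K^int + K^ext`. -/
def Kfull (n : ℕ) (s : ℝ) (u : Rn n → ℝ) (Ω : Set (Rn n)) : ℝ≥0∞ :=
  Kint n s u Ω + Kext n s u Ω

/-- Fractional Allen–Cahn energy `F₁(u,Ω) = K(u,Ω) + ∫_Ω W(u)`. -/
def FracAC (n : ℕ) (s : ℝ) (W : ℝ → ℝ) (u : Rn n → ℝ) (Ω : Set (Rn n)) : ℝ≥0∞ :=
  Kfull n s u Ω + PotTerm n W u Ω

/-- `F^int_ε` for `s ∈ [1/2,1)` (with the logarithmic scaling at `s = 1/2`). -/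
def FintH (n : ℕ) (s : ℝ) (W : ℝ → ℝ) (ε : ℝ) (u : Rn n → ℝ) (Ω : Set (Rn n)) : ℝ≥0∞ :=
  if s = (1/2 : ℝ) then
    ENNReal.ofReal |Real.log ε|⁻¹ * Kint n s u Ω
      + ENNReal.ofReal (|ε * Real.log ε|⁻¹ / 2) * PotTerm n W u Ω
  else
    ENNReal.ofReal (ε ^ (2 * s - 1)) * Kint n s u Ω
      + ENNReal.ofReal (ε⁻¹ / 2) * PotTerm n W u Ω

/-- `F^ext_ε` for `s ∈ [1/2,1)`. -/
def FextH (n : ℕ) (s : ℝ) (W : ℝ → ℝ) (ε : ℝ) (u : Rn n → ℝ) (Ω : Set (Rn n)) : ℝ≥0∞ :=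
  if s = (1/2 : ℝ) then
    ENNReal.ofReal |Real.log ε|⁻¹ * Kext n s u Ω
      + ENNReal.ofReal (|ε * Real.log ε|⁻¹ / 2) * PotTerm n W u Ω
  else
    ENNReal.ofReal (ε ^ (2 * s - 1)) * Kext n s u Ω
      + ENNReal.ofReal (ε⁻¹ / 2) * PotTerm n W u Ω

/-- `F_ε = F^int_ε + F^ext_ε` for `s ∈ [1/2,1)`. -/
def FH (n : ℕ) (s : ℝ) (W : ℝ → ℝ) (ε : ℝ) (u : Rn n → ℝ) (Ω : Set (Rn n)) : ℝ≥0∞ :=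
  FintH n s W ε u Ω + FextH n s W ε u Ω


/-! ### Geometry of the Lipschitz domain -/

lemma aux_proj_norm {n : ℕ} (v w : Rn n) (hv : ‖v‖ = 1) : ‖w - ⟪w, v⟫ • v‖ ≤ 2 * ‖w‖ := by
  have h1 : ‖⟪w, v⟫ • v‖ ≤ ‖w‖ := by
    rw [norm_smul, hv, mul_one]
    simpa [hv] using norm_inner_le_norm (𝕜 := ℝ) w v
  calc ‖w - ⟪w, v⟫ • v‖ ≤ ‖w‖ + ‖⟪w, v⟫ • v‖ := norm_sub_le _ _
    _ ≤ 2 * ‖w‖ := by linarith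

lemma aux_geo {n : ℕ} {Ω : Set (Rn n)} (hΩo : IsOpen Ω) (hlip : HasLipschitzBoundary n Ω)
    (x0 : Rn n) (hx0 : x0 ∈ closure Ω) :
    ∃ r > (0:ℝ), ∃ v : Rn n, ‖v‖ ≤ 1 ∧ ∃ c > (0:ℝ), c ≤ 1 ∧ ∃ ε0 > (0:ℝ), ∀ ε, 0 < ε → ε < ε0 →
      ∀ x ∈ ball x0 r, ∀ y ∈ Ω, ‖x - y‖ ≤ c * ε → ∀ z, ‖z - (x - ε • v)‖ ≤ c * ε → z ∈ Ω := by
  by_cases hx : x0 ∈ Ω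
  · obtain ⟨r, hr, hb⟩ := Metric.isOpen_iff.1 hΩo x0 hx
    refine ⟨r/2, by positivity, 0, by simp, 1, one_pos, le_rfl, r/2, by positivity, ?_⟩
    intro ε hε hε' x hx y _ _ z hz
    apply hb
    rw [mem_ball, dist_eq_norm] at hx ⊢
    simp only [smul_zero, sub_zero, one_mul] at hz
    calc ‖z - x0‖ = ‖(z - x) + (x - x0)‖ := by congr 1; abel
      _ ≤ ‖z - x‖ + ‖x - x0‖ := norm_add_le _ _
      _ < r := by linarith
  · have hfr : x0 ∈ frontier Ω := by
      rw [hΩo.frontier_eq]; exact ⟨hx0, hx⟩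
    obtain ⟨r, hr, v, hv, L, f, hf, hΩ⟩ := hlip x0 hfr
    have hL : (0:ℝ) ≤ L := L.2
    have hcpos : (0:ℝ) < 1 / (4 * (1 + 2 * (L:ℝ))) := by positivity
    have hc1 : 1 / (4 * (1 + 2 * (L:ℝ))) ≤ 1 := by
      rw [div_le_one (by positivity)]; linarith
    set c := 1 / (4 * (1 + 2 * (L:ℝ))) with hc
    have hc2 : c * (2 + 4 * L) = 1 / 2 := by rw [hc]; field_simp; ring
    refine ⟨r/2, by positivity, v, hv.le, c, hcpos, hc1, r/4, by positivity, ?_⟩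
    intro ε hε hε' x hx y hy hxy z hz
    rw [mem_ball, dist_eq_norm] at hx
    have hcε : c * ε ≤ ε := by nlinarith
    have hyb : y ∈ ball x0 r := by
      rw [mem_ball, dist_eq_norm]
      calc ‖y - x0‖ = ‖(x - x0) - (x - y)‖ := by congr 1; abel
        _ ≤ ‖x - x0‖ + ‖x - y‖ := norm_sub_le _ _
        _ < r := by linarith
    have hzb : z ∈ ball x0 r := by
      rw [mem_ball, dist_eq_norm]
      calc ‖z - x0‖ = ‖(z - (x - ε • v)) + (x - x0) - ε • v‖ := by congr 1; abel
        _ ≤ ‖(z - (x - ε • v))‖ + ‖x - x0‖ + ‖ε • v‖ :=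
          (norm_sub_le _ _).trans (add_le_add_left (norm_add_le _ _) _)
        _ < r := by
          rw [norm_smul, hv, Real.norm_of_nonneg hε.le]; linarith
    have hyf : ⟪y, v⟫ < f (y - ⟪y, v⟫ • v) := by
      have : y ∈ Ω ∩ ball x0 r := ⟨hy, hyb⟩
      rw [hΩ] at this; exact this.2
    suffices h : z ∈ Ω ∩ ball x0 r from h.1
    rw [hΩ]
    refine ⟨hzb, ?_⟩
    set w := z - y + ε • v with hw
    have hwn : ‖w‖ ≤ 2 * (c * ε) := by
      calc ‖w‖ = ‖(z - (x - ε • v)) + (x - y)‖ := by rw [hw]; congr 1; abel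
        _ ≤ _ := (norm_add_le _ _)
        _ ≤ _ := by linarith
    have hvv : ⟪v, v⟫ = (1:ℝ) := by rw [real_inner_self_eq_norm_sq, hv]; norm_num
    have hzw : z = y + w - ε • v := by rw [hw]; abel
    have h1 : ⟪z, v⟫ = ⟪y, v⟫ + ⟪w, v⟫ - ε := by
      rw [hzw, inner_sub_left, inner_add_left, real_inner_smul_left, hvv, mul_one]
    have h2 : ⟪w, v⟫ ≤ ‖w‖ := by
      have := real_inner_le_norm w v
      rwa [hv, mul_one] at this
    have h3 : (z - ⟪z, v⟫ • v) - (y - ⟪y, v⟫ • v) = w - ⟪w, v⟫ • v := by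
      rw [h1, sub_smul, add_smul]
      nth_rewrite 1 [hzw]
      abel
    have h4 : |f (z - ⟪z, v⟫ • v) - f (y - ⟪y, v⟫ • v)| ≤ L * (2 * (2 * (c * ε))) := by
      have := hf.dist_le_mul (z - ⟪z, v⟫ • v) (y - ⟪y, v⟫ • v)
      rw [Real.dist_eq, dist_eq_norm, h3] at this
      refine this.trans (mul_le_mul_of_nonneg_left ?_ hL)
      exact (aux_proj_norm v w hv).trans (by linarith)
    have h5 := (abs_le.1 h4).1
    show ⟪z, v⟫ < f (z - ⟪z, v⟫ • v)
    rw [h1]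
    have h6 : 2 * (c * ε) + L * (2 * (2 * (c * ε))) = ε / 2 := by
      calc _ = (c * (2 + 4 * L)) * ε := by ring
        _ = ε / 2 := by rw [hc2]; ring
    rw [h1] at h5
    linarith

lemma aux_null {n : ℕ} {Ω : Set (Rn n)} (hΩo : IsOpen Ω) (hlip : HasLipschitzBoundary n Ω) :
    volume (frontier Ω) = 0 := by
  apply measure_null_of_locally_null
  intro x0 hx0
  obtain ⟨r, hr, v, hv, L, f, hf, hΩ⟩ := hlip x0 hx0
  have hvv : ⟪v, v⟫ = (1:ℝ) := by rw [real_inner_self_eq_norm_sq, hv]; norm_num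
  have hcont : Continuous fun y : Rn n => f (y - ⟪y, v⟫ • v) :=
    hf.continuous.comp (by fun_prop)
  have hcont2 : Continuous fun y : Rn n => ⟪y, v⟫ := by fun_prop
  refine ⟨frontier Ω ∩ ball x0 r, inter_mem self_mem_nhdsWithin
    (mem_nhdsWithin_of_mem_nhds (ball_mem_nhds x0 hr)), ?_⟩
  set S : Set (Rn n) := {y ∈ ball x0 r | ⟪y, v⟫ = f (y - ⟪y, v⟫ • v)} with hS
  refine measure_mono_null (t := S) ?_ ?_
  · rintro y ⟨hy, hyb⟩
    rw [hΩo.frontier_eq] at hy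
    refine ⟨hyb, le_antisymm ?_ ?_⟩
    · by_contra! hlt
      have hop : IsOpen {y : Rn n | y ∈ ball x0 r ∧ f (y - ⟪y, v⟫ • v) < ⟪y, v⟫} :=
        isOpen_ball.inter (isOpen_lt hcont hcont2)
      obtain ⟨z, hz, hzΩ⟩ := mem_closure_iff.1 hy.1 _ hop ⟨hyb, hlt⟩
      have : z ∈ Ω ∩ ball x0 r := ⟨hzΩ, hz.1⟩
      rw [hΩ] at this
      exact absurd this.2 (not_lt.2 hz.2.le)
    · by_contra! hlt
      have : y ∈ Ω ∩ ball x0 r := by rw [hΩ]; exact ⟨hyb, hlt⟩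
      exact hy.2 this.1
  · refine Measure.addHaar_eq_zero_of_disjoint_translates_aux (μ := volume)
      (u := fun k : ℕ => (1 / ((k:ℝ) + 1)) • v) (Metric.isBounded_ball.subset (sep_subset _ _))
      ?_ ?_ ?_
    · refine (Metric.isBounded_closedBall (x := (0 : Rn n)) (r := 1)).subset ?_
      rintro _ ⟨k, rfl⟩
      simp only [mem_closedBall, dist_zero_right, norm_smul, hv, mul_one]
      rw [Real.norm_of_nonneg (by positivity), div_le_one (by positivity)]
      linarith [(Nat.cast_nonneg k : (0:ℝ) ≤ k)]
    · intro k l hkl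
      rw [Function.onFun, Set.disjoint_left]
      rintro y hy1 hy2
      simp only [singleton_add, image_add_left, mem_preimage] at hy1 hy2
      have e : ∀ k : ℕ, (-((1 / ((k:ℝ) + 1)) • v) + y) ∈ S →
          ⟪y, v⟫ - (1 / ((k:ℝ) + 1)) = f (y - ⟪y, v⟫ • v) := by
        intro k hk
        have := hk.2
        have h1 : ⟪-((1 / ((k:ℝ) + 1)) • v) + y, v⟫ = ⟪y, v⟫ - (1 / ((k:ℝ) + 1)) := by
          rw [inner_add_left, inner_neg_left, real_inner_smul_left, hvv]; ring
        rw [h1] at this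
        rw [this]
        congr 1
        rw [sub_smul]; abel
      have h1 := e k hy1
      have h2 := e l hy2
      have h3 : (1 / ((k:ℝ) + 1)) = (1 / ((l:ℝ) + 1)) := by linarith
      have h4 : (k:ℝ) = l := by
        field_simp at h3
        linarith
      exact hkl (by exact_mod_cast h4)
    · exact measurableSet_ball.inter (measurableSet_eq_fun hcont2.measurable hcont.measurable)


/-! ### Constants and radial integrals -/

/-- real-valued volume of the unit ball -/
def bvol (m : ℕ) : ℝ := √Real.pi ^ m / Real.Gamma ((m:ℝ) / 2 + 1)

lemma bvol_pos (m : ℕ) : 0 < bvol m := by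
  unfold bvol
  have : 0 < Real.Gamma ((m:ℝ) / 2 + 1) := Real.Gamma_pos_of_pos (by positivity)
  have := Real.pi_pos
  positivity

lemma omega_eq (m : ℕ) : omegaBall m = ENNReal.ofReal (bvol m) := by
  unfold omegaBall bvol
  rcases Nat.eq_zero_or_pos m with rfl | hm
  · have : ball (0 : EuclideanSpace ℝ (Fin 0)) 1 = univ := by
      ext x; simp [Subsingleton.elim x 0]
    rw [this]
    have h := (EuclideanSpace.volume_preserving_symm_measurableEquiv_toLp (Fin 0)).measure_preimage
      (s := univ) MeasurableSet.univ.nullMeasurableSet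
    rw [preimage_univ] at h
    rw [h, volume_pi, Measure.pi_of_empty, Measure.dirac_apply_of_mem (mem_univ _)]
    simp
  · have : Nonempty (Fin m) := ⟨⟨0, hm⟩⟩
    rw [EuclideanSpace.volume_ball]
    simp

lemma omega_ratio (n : ℕ) (hn : 1 ≤ n) : √(n:ℝ) * bvol n / 3 ≤ bvol (n - 1) := by
  obtain ⟨m, rfl⟩ : ∃ m, n = m + 1 := ⟨n - 1, by omega⟩
  simp only [Nat.add_sub_cancel]
  unfold bvol
  have hN : (0:ℝ) < (m + 1 : ℕ) := by positivity
  set N : ℝ := ((m + 1 : ℕ) : ℝ) with hNdef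
  have hm : (m:ℝ) = N - 1 := by rw [hNdef]; push_cast; ring
  have hG0 : 0 < Real.Gamma (N / 2) := Real.Gamma_pos_of_pos (by positivity)
  have hG1 : Real.Gamma (N / 2 + 1) = N / 2 * Real.Gamma (N / 2) :=
    Real.Gamma_add_one (by positivity)
  have hGm : 0 < Real.Gamma ((m:ℝ) / 2 + 1) := Real.Gamma_pos_of_pos (by positivity)
  have hG1p : 0 < Real.Gamma (N / 2 + 1) := Real.Gamma_pos_of_pos (by positivity)
  have key := Real.Gamma_mul_add_mul_le_rpow_Gamma_mul_rpow_Gamma (s := N / 2) (t := N / 2 + 1)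
    (a := 1/2) (b := 1/2) (by positivity) (by positivity) (by norm_num) (by norm_num) (by norm_num)
  have e : 1 / 2 * (N / 2) + 1 / 2 * (N / 2 + 1) = (m:ℝ) / 2 + 1 := by rw [hm]; ring
  rw [e, ← Real.sqrt_eq_rpow, ← Real.sqrt_eq_rpow, ← Real.sqrt_mul hG0.le] at key
  have hsq : Real.Gamma ((m:ℝ) / 2 + 1) * √N ≤ √2 * Real.Gamma (N / 2 + 1) := by
    calc Real.Gamma ((m:ℝ) / 2 + 1) * √N
        ≤ √(Real.Gamma (N / 2) * Real.Gamma (N / 2 + 1)) * √N := by gcongr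
      _ = √(2 * Real.Gamma (N / 2 + 1) ^ 2) := by
        rw [← Real.sqrt_mul (by positivity)]
        congr 1
        rw [hG1]; ring
      _ = √2 * Real.Gamma (N / 2 + 1) := by
        rw [Real.sqrt_mul (by norm_num), Real.sqrt_sq hG1p.le]
  have h2 : √Real.pi * √2 ≤ 3 := by
    rw [← Real.sqrt_mul Real.pi_pos.le, Real.sqrt_le_left (by norm_num)]
    nlinarith [Real.pi_lt_d2]
  rw [pow_succ, div_le_iff₀ (by norm_num), mul_div_assoc', div_mul_eq_mul_div,
    div_le_div_iff₀ hG1p hGm]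
  have hpp : 0 ≤ √Real.pi ^ m := by positivity
  calc √N * (√Real.pi ^ m * √Real.pi) * Real.Gamma ((m:ℝ) / 2 + 1)
      = √Real.pi ^ m * √Real.pi * (Real.Gamma ((m:ℝ) / 2 + 1) * √N) := by ring
    _ ≤ √Real.pi ^ m * √Real.pi * (√2 * Real.Gamma (N / 2 + 1)) := by gcongr
    _ = √Real.pi ^ m * Real.Gamma (N / 2 + 1) * (√Real.pi * √2) := by ring
    _ ≤ √Real.pi ^ m * Real.Gamma (N / 2 + 1) * 3 := by gcongr
    _ = _ := by ring

lemma radial_lintegral {n : ℕ} (hn : 1 ≤ n) {f : ℝ → ℝ} (hf0 : ∀ y, 0 ≤ y → 0 ≤ f y)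
    (hf : IntegrableOn (fun y : ℝ => y ^ (n - 1) * f y) (Ioi 0)) :
    ∫⁻ x : Rn n, ENNReal.ofReal (f ‖x‖) =
      ENNReal.ofReal (n * bvol n * ∫ y in Ioi (0:ℝ), y ^ (n - 1) * f y) := by
  have : Nonempty (Fin n) := ⟨⟨0, hn⟩⟩
  have hfin : Module.finrank ℝ (Rn n) = n := by simp
  have : Nontrivial (Rn n) := Module.nontrivial_of_finrank_pos (R := ℝ) (by omega)
  have hint : Integrable (fun x : Rn n => f ‖x‖) := by
    rw [integrable_fun_norm_addHaar (volume : Measure (Rn n)), hfin]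
    exact hf
  rw [← ofReal_integral_eq_lintegral_ofReal hint
    (ae_of_all _ fun x => hf0 _ (norm_nonneg x)), integral_fun_norm_addHaar, hfin]
  congr 1
  have : (volume : Measure (Rn n)).real (ball 0 1) = bvol n := by
    have h := omega_eq n
    unfold omegaBall at h
    rw [Measure.real, h, ENNReal.toReal_ofReal (bvol_pos n).le]
  rw [this, nsmul_eq_mul, smul_eq_mul, mul_assoc]
  rfl

lemma radial_near {n : ℕ} (hn : 1 ≤ n) {s r : ℝ} (hs : s < 1/2) (hr : 0 < r) :
    ∫⁻ h in ball (0 : Rn n) r, ENNReal.ofReal (‖h‖ ^ (1 - (n:ℝ) - 2 * s)) =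
      ENNReal.ofReal (n * bvol n * (r ^ (1 - 2 * s) / (1 - 2 * s))) := by
  have key : ∀ y ∈ Ioi (0:ℝ), y ^ (n - 1) * (Iio r).indicator (fun y => y ^ (1 - (n:ℝ) - 2 * s)) y
      = (Ioo 0 r).indicator (fun y => y ^ (-(2 * s))) y := by
    intro y hy
    have hy' : 0 < y := hy
    by_cases h : y < r
    · rw [indicator_of_mem (by exact h), indicator_of_mem (by exact ⟨hy', h⟩), ← Real.rpow_natCast,
        ← Real.rpow_add hy']
      congr 1
      push_cast [hn]; ring
    · rw [indicator_of_notMem (by exact h), indicator_of_notMem (fun h' => h h'.2), mul_zero]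
  have hI : IntegrableOn (fun y : ℝ => y ^ (-(2 * s))) (Ioo 0 r) := by
    have := (intervalIntegral.intervalIntegrable_rpow' (a := 0) (b := r) (r := -(2 * s))
      (by linarith))
    rw [intervalIntegrable_iff_integrableOn_Ioo_of_le hr.le] at this
    exact this
  have := radial_lintegral hn (f := (Iio r).indicator (fun y => y ^ (1 - (n:ℝ) - 2 * s))) ?_ ?_
  · rw [← lintegral_indicator measurableSet_ball]
    have e : ∀ x : Rn n, (ball (0 : Rn n) r).indicator
        (fun h => ENNReal.ofReal (‖h‖ ^ (1 - (n:ℝ) - 2 * s))) x =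
        ENNReal.ofReal ((Iio r).indicator (fun y => y ^ (1 - (n:ℝ) - 2 * s)) ‖x‖) := by
      intro x
      by_cases h : ‖x‖ < r
      · rw [indicator_of_mem (by simpa using h), indicator_of_mem (by exact h)]
      · rw [indicator_of_notMem (by simpa using h), indicator_of_notMem (by exact h)]; simp
    simp_rw [e]
    rw [this, setIntegral_congr_fun measurableSet_Ioi key, setIntegral_indicator measurableSet_Ioo]
    congr 2
    have : Ioi (0:ℝ) ∩ Ioo 0 r = Ioo 0 r := inter_eq_right.2 (fun y hy => hy.1)
    rw [this, ← integral_Ioc_eq_integral_Ioo, ← intervalIntegral.integral_of_le hr.le,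
      integral_rpow (Or.inl (by linarith))]
    have e1 : -(2 * s) + 1 = 1 - 2 * s := by ring
    rw [e1, Real.zero_rpow (by linarith), sub_zero]
  · intro y hy
    by_cases h' : y < r
    · rw [indicator_of_mem (by exact h')]; positivity
    · rw [indicator_of_notMem (by exact h')]
  · rw [integrableOn_congr_fun key measurableSet_Ioi]
    exact ((integrable_indicator_iff measurableSet_Ioo).2 hI).integrableOn

lemma radial_far {n : ℕ} (hn : 1 ≤ n) {s r : ℝ} (hs : 0 < s) (hr : 0 < r) :
    ∫⁻ h in (ball (0 : Rn n) r)ᶜ, ENNReal.ofReal (‖h‖ ^ (-((n:ℝ) + 2 * s))) =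
      ENNReal.ofReal (n * bvol n * (r ^ (-(2 * s)) / (2 * s))) := by
  have key : ∀ y ∈ Ioi (0:ℝ), y ^ (n - 1) * (Ici r).indicator (fun y => y ^ (-((n:ℝ) + 2 * s))) y
      = (Ici r).indicator (fun y => y ^ (-(2 * s) - 1)) y := by
    intro y hy
    have hy' : 0 < y := hy
    by_cases h : r ≤ y
    · rw [indicator_of_mem (by exact h), indicator_of_mem (by exact h), ← Real.rpow_natCast,
        ← Real.rpow_add hy']
      congr 1
      push_cast [hn]; ring
    · rw [indicator_of_notMem (by exact h), indicator_of_notMem (by exact h), mul_zero]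
  have hI : IntegrableOn (fun y : ℝ => y ^ (-(2 * s) - 1)) (Ici r) := by
    rw [integrableOn_Ici_iff_integrableOn_Ioi]
    exact integrableOn_Ioi_rpow_of_lt (by linarith) hr
  have := radial_lintegral hn (f := (Ici r).indicator (fun y => y ^ (-((n:ℝ) + 2 * s)))) ?_ ?_
  · rw [← lintegral_indicator measurableSet_ball.compl]
    have e : ∀ x : Rn n, ((ball (0 : Rn n) r)ᶜ).indicator
        (fun h => ENNReal.ofReal (‖h‖ ^ (-((n:ℝ) + 2 * s)))) x =
        ENNReal.ofReal ((Ici r).indicator (fun y => y ^ (-((n:ℝ) + 2 * s))) ‖x‖) := by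
      intro x
      by_cases h : r ≤ ‖x‖
      · rw [indicator_of_mem (by simpa using h), indicator_of_mem (by exact h)]
      · rw [indicator_of_notMem (by simpa using h), indicator_of_notMem (by exact h)]; simp
    simp_rw [e]
    rw [this, setIntegral_congr_fun measurableSet_Ioi key, setIntegral_indicator measurableSet_Ici]
    congr 2
    have : Ioi (0:ℝ) ∩ Ici r = Ici r := inter_eq_right.2 (fun y hy => lt_of_lt_of_le hr hy)
    rw [this, integral_Ici_eq_integral_Ioi, integral_Ioi_rpow_of_lt (by linarith) hr]
    have e1 : -(2 * s) - 1 + 1 = -(2 * s) := by ring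
    rw [e1, neg_div_neg_eq]
  · intro y hy
    by_cases h' : r ≤ y
    · rw [indicator_of_mem (by exact h')]; positivity
    · rw [indicator_of_notMem (by exact h')]
  · rw [integrableOn_congr_fun key measurableSet_Ioi]
    exact ((integrable_indicator_iff measurableSet_Ici).2 hI).integrableOn


/-! ### The directional average -/

lemma iso_invariant {n : ℕ} (w : ℝ → ℝ) (r : ℝ) (p q : Rn n) (hpq : ‖p‖ = ‖q‖) :
    ∫⁻ h in ball (0 : Rn n) r, ENNReal.ofReal (w ‖h‖ * ⟪p, h⟫ ^ 2) =
    ∫⁻ h in ball (0 : Rn n) r, ENNReal.ofReal (w ‖h‖ * ⟪q, h⟫ ^ 2) := by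
  set T : Rn n ≃ₗᵢ[ℝ] Rn n := Submodule.reflection (ℝ ∙ (p - q))ᗮ with hT
  have hTp : T p = q := Submodule.reflection_sub hpq
  have hmp : MeasurePreserving T volume volume := T.measurePreserving
  have hpre : T ⁻¹' (ball (0 : Rn n) r) = ball 0 r := by
    rw [LinearIsometryEquiv.preimage_ball]; simp
  have h := hmp.setLIntegral_comp_preimage_emb T.toHomeomorph.measurableEmbedding
    (fun h => ENNReal.ofReal (w ‖h‖ * ⟪q, h⟫ ^ 2)) (ball 0 r)
  rw [hpre] at h
  rw [← h]
  simp_rw [LinearIsometryEquiv.norm_map, ← hTp, LinearIsometryEquiv.inner_map_map]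

lemma iso_average {n : ℕ} (w : ℝ → ℝ) (hw0 : ∀ t, 0 ≤ t → 0 ≤ w t) (hw : Measurable w) (r : ℝ)
    (p : Rn n) (hp : ‖p‖ = 1) :
    n * ∫⁻ h in ball (0 : Rn n) r, ENNReal.ofReal (w ‖h‖ * ⟪p, h⟫ ^ 2) =
    ∫⁻ h in ball (0 : Rn n) r, ENNReal.ofReal (w ‖h‖ * ‖h‖ ^ 2) := by
  have h1 : ∀ h : Rn n, ENNReal.ofReal (w ‖h‖ * ‖h‖ ^ 2) =
      ∑ i : Fin n, ENNReal.ofReal (w ‖h‖ * ⟪EuclideanSpace.single i (1:ℝ), h⟫ ^ 2) := by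
    intro h
    rw [← ENNReal.ofReal_sum_of_nonneg, ← Finset.mul_sum, EuclideanSpace.norm_sq_eq]
    · congr 2
      refine Finset.sum_congr rfl fun i _ => ?_
      rw [EuclideanSpace.inner_single_left]
      simp
    · intro i _
      have := hw0 _ (norm_nonneg h)
      positivity
  simp_rw [h1]
  rw [lintegral_finsetSum]
  · rw [Finset.sum_congr rfl (fun i _ => iso_invariant w r (EuclideanSpace.single i (1:ℝ)) p
      (by rw [hp]; simp))]
    simp
  · intro i _
    refine Measurable.ennreal_ofReal ?_
    refine (hw.comp measurable_norm).mul ?_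
    refine Measurable.pow_const ?_ 2
    exact (by fun_prop : Continuous fun h : Rn n => ⟪EuclideanSpace.single i (1:ℝ), h⟫).measurable

lemma theta_unit {n : ℕ} (hn : 1 ≤ n) {s r : ℝ} (hs : s < 1/2) (hr : 0 < r)
    (p : Rn n) (hp : ‖p‖ = 1) :
    ∫⁻ h in ball (0 : Rn n) r,
      ENNReal.ofReal (‖h‖ ^ (-((n:ℝ) + 2 * s))) * ENNReal.ofReal (-⟪p, h⟫) ≤
    ENNReal.ofReal (√(n:ℝ) * bvol n * r ^ (1 - 2 * s) / (2 * (1 - 2 * s))) := by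
  set k : Rn n → ℝ := fun h => ‖h‖ ^ (-((n:ℝ) + 2 * s)) with hk
  have hk0 : ∀ h, 0 ≤ k h := fun h => by positivity
  have hkm : Measurable k := measurable_norm.pow_const _
  have hpm : Measurable fun h : Rn n => ⟪p, h⟫ :=
    (by fun_prop : Continuous fun h : Rn n => ⟪p, h⟫).measurable
  have hnpos : (0:ℝ) < n := by exact_mod_cast hn
  have hsn : 0 < √(n:ℝ) := Real.sqrt_pos.2 hnpos
  have hsn2 : √(n:ℝ) * √(n:ℝ) = n := Real.mul_self_sqrt hnpos.le
  set A := ∫⁻ h in ball (0 : Rn n) r, ENNReal.ofReal (k h) * ENNReal.ofReal (-⟪p, h⟫) with hA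
  set A' := ∫⁻ h in ball (0 : Rn n) r, ENNReal.ofReal (k h) * ENNReal.ofReal (⟪p, h⟫) with hA'
  have hAA : A = A' := by
    have hmp : MeasurePreserving (fun x : Rn n => -x) volume volume :=
      Measure.measurePreserving_neg _
    have hpre : (fun x : Rn n => -x) ⁻¹' (ball (0 : Rn n) r) = ball 0 r := by
      ext x; simp
    have h := hmp.setLIntegral_comp_preimage_emb (Homeomorph.neg (Rn n)).measurableEmbedding
      (fun h => ENNReal.ofReal (k h) * ENNReal.ofReal (⟪p, h⟫)) (ball 0 r)
    rw [hpre] at h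
    rw [hA', ← h, hA]
    simp [hk]
  set w : ℝ → ℝ := fun t => t ^ (-((n:ℝ) + 2 * s) - 1) with hw
  have hav := iso_average (n := n) w (fun t ht => Real.rpow_nonneg ht _)
    (measurable_id.pow_const _) r p hp
  set Q := ∫⁻ h in ball (0 : Rn n) r, ENNReal.ofReal (w ‖h‖ * ⟪p, h⟫ ^ 2) with hQ
  set τ := n * bvol n * (r ^ (1 - 2 * s) / (1 - 2 * s)) with hτ
  have hτ0 : 0 ≤ τ := by
    have := bvol_pos n
    have : 0 < 1 - 2 * s := by linarith
    positivity
  have hnear := radial_near hn hs hr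
  have hw2 : ∀ h : Rn n, w ‖h‖ * ‖h‖ ^ 2 ≤ ‖h‖ ^ (1 - (n:ℝ) - 2 * s) := by
    intro h
    rcases eq_or_lt_of_le (norm_nonneg h) with h0 | h0
    · rw [← h0]; simp only [ne_eq, OfNat.ofNat_ne_zero, not_false_eq_true, zero_pow, mul_zero]
      positivity
    · rw [hw]
      simp only
      rw [← Real.rpow_natCast, ← Real.rpow_add h0]
      apply le_of_eq; congr 1; push_cast; ring
  have hkh : ∀ h : Rn n, k h * |⟪p, h⟫| ≤
      √(n:ℝ) / 2 * (w ‖h‖ * ⟪p, h⟫ ^ 2) + 1 / (2 * √(n:ℝ)) * ‖h‖ ^ (1 - (n:ℝ) - 2 * s) := by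
    intro h
    rcases eq_or_lt_of_le (norm_nonneg h) with h0 | h0
    · have : h = 0 := norm_eq_zero.1 h0.symm
      subst this
      simp only [inner_zero_right, abs_zero, mul_zero, ne_eq, OfNat.ofNat_ne_zero,
        not_false_eq_true, zero_pow, zero_add]
      positivity
    · have e1 : w ‖h‖ = k h / ‖h‖ := by
        rw [hw, hk]; simp only; rw [Real.rpow_sub_one h0.ne']
      have e2 : ‖h‖ ^ (1 - (n:ℝ) - 2 * s) = k h * ‖h‖ := by
        rw [hk]; simp only; rw [← Real.rpow_add_one h0.ne']; congr 1; ring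
      rw [e1, e2]
      have h3 : |⟪p, h⟫| ≤ √(n:ℝ) / 2 * (⟪p, h⟫ ^ 2 / ‖h‖) + 1 / (2 * √(n:ℝ)) * ‖h‖ := by
        rw [← sq_abs ⟪p, h⟫]
        set a := |⟪p, h⟫|
        have : √(n:ℝ) / 2 * (a ^ 2 / ‖h‖) + 1 / (2 * √(n:ℝ)) * ‖h‖ - a =
          (√(n:ℝ) * a - ‖h‖) ^ 2 / (2 * √(n:ℝ) * ‖h‖) := by
          field_simp; ring
        have h4 : 0 ≤ (√(n:ℝ) * a - ‖h‖) ^ 2 / (2 * √(n:ℝ) * ‖h‖) := by positivity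
        linarith
      calc k h * |⟪p, h⟫| ≤ k h * (√(n:ℝ) / 2 * (⟪p, h⟫ ^ 2 / ‖h‖) + 1 / (2 * √(n:ℝ)) * ‖h‖) :=
            mul_le_mul_of_nonneg_left h3 (hk0 h)
        _ = _ := by ring
  have hQle : (n:ℝ≥0∞) * Q ≤ ENNReal.ofReal τ := by
    rw [hav, ← hnear]
    exact lintegral_mono fun h => ENNReal.ofReal_le_ofReal (hw2 h)
  have hQle2 : Q ≤ ENNReal.ofReal (τ / n) := by
    rw [ENNReal.ofReal_div_of_pos hnpos, ENNReal.ofReal_natCast,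
      ENNReal.le_div_iff_mul_le (Or.inl (by exact_mod_cast hnpos.ne')) (Or.inl (by simp)), mul_comm]
    exact hQle
  have hwm : Measurable fun h : Rn n => w ‖h‖ * ⟪p, h⟫ ^ 2 :=
    (measurable_norm.pow_const _).mul (hpm.pow_const 2)
  have h2A : 2 * A ≤ ENNReal.ofReal (τ / √(n:ℝ)) := by
    calc 2 * A = A + A' := by rw [← hAA, two_mul]
      _ = ∫⁻ h in ball (0 : Rn n) r, (ENNReal.ofReal (k h) * ENNReal.ofReal (-⟪p, h⟫) +
          ENNReal.ofReal (k h) * ENNReal.ofReal (⟪p, h⟫)) := by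
        rw [lintegral_add_left]
        exact hkm.ennreal_ofReal.mul hpm.neg.ennreal_ofReal
      _ ≤ ∫⁻ h in ball (0 : Rn n) r, (ENNReal.ofReal (√(n:ℝ) / 2) *
            ENNReal.ofReal (w ‖h‖ * ⟪p, h⟫ ^ 2) +
          ENNReal.ofReal (1 / (2 * √(n:ℝ))) * ENNReal.ofReal (‖h‖ ^ (1 - (n:ℝ) - 2 * s))) := by
        refine lintegral_mono fun h => ?_
        rw [← mul_add]
        have e : ENNReal.ofReal (-⟪p, h⟫) + ENNReal.ofReal (⟪p, h⟫) = ENNReal.ofReal |⟪p, h⟫| := by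
          rcases le_total 0 ⟪p, h⟫ with h0 | h0
          · rw [abs_of_nonneg h0, ENNReal.ofReal_of_nonpos (neg_nonpos.2 h0), zero_add]
          · rw [abs_of_nonpos h0, ENNReal.ofReal_of_nonpos h0, add_zero]
        have hw0 : 0 ≤ w ‖h‖ := Real.rpow_nonneg (norm_nonneg _) _
        rw [e, ← ENNReal.ofReal_mul (hk0 h), ← ENNReal.ofReal_mul (by positivity),
          ← ENNReal.ofReal_mul (by positivity), ← ENNReal.ofReal_add (by positivity)
          (by positivity)]
        exact ENNReal.ofReal_le_ofReal (hkh h)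
      _ = ENNReal.ofReal (√(n:ℝ) / 2) * Q + ENNReal.ofReal (1 / (2 * √(n:ℝ))) *
          ENNReal.ofReal τ := by
        rw [lintegral_add_left (hwm.ennreal_ofReal.const_mul _),
          lintegral_const_mul _ hwm.ennreal_ofReal,
          lintegral_const_mul _ (measurable_norm.pow_const _).ennreal_ofReal, hnear]
      _ ≤ ENNReal.ofReal (√(n:ℝ) / 2) * ENNReal.ofReal (τ / n) +
          ENNReal.ofReal (1 / (2 * √(n:ℝ))) * ENNReal.ofReal τ := by gcongr
      _ = ENNReal.ofReal (τ / √(n:ℝ)) := by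
        rw [← ENNReal.ofReal_mul (by positivity), ← ENNReal.ofReal_mul (by positivity),
          ← ENNReal.ofReal_add (by positivity) (by positivity)]
        congr 1
        nth_rewrite 2 [← hsn2]
        field_simp; ring
  have hs2 : (0:ℝ) < 1 - 2 * s := by linarith
  have e : √(n:ℝ) * bvol n * r ^ (1 - 2 * s) / (2 * (1 - 2 * s)) = (τ / √(n:ℝ)) / 2 := by
    rw [hτ]; nth_rewrite 2 [← hsn2]; field_simp
  rw [e, ENNReal.ofReal_div_of_pos two_pos, ENNReal.le_div_iff_mul_le (by simp) (by simp), mul_comm]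
  simpa using h2A

lemma theta_bound {n : ℕ} (hn : 1 ≤ n) {s r : ℝ} (hs : s < 1/2) (hr : 0 < r) (p : Rn n) :
    ∫⁻ h in ball (0 : Rn n) r,
      ENNReal.ofReal (‖h‖ ^ (-((n:ℝ) + 2 * s))) * ENNReal.ofReal (-⟪p, h⟫) ≤
    ENNReal.ofReal (√(n:ℝ) * bvol n * r ^ (1 - 2 * s) / (2 * (1 - 2 * s))) *
      ENNReal.ofReal ‖p‖ := by
  rcases eq_or_ne p 0 with rfl | hp
  · simp
  have hp0 : 0 < ‖p‖ := norm_pos_iff.2 hp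
  have hu : ‖‖p‖⁻¹ • p‖ = 1 := by
    rw [norm_smul, norm_inv, norm_norm, inv_mul_cancel₀ hp0.ne']
  have h := theta_unit hn hs hr (‖p‖⁻¹ • p) hu
  refine le_trans (le_of_eq ?_) (mul_le_mul_left h (ENNReal.ofReal ‖p‖))
  rw [← lintegral_mul_const'' _ ?_]
  · refine lintegral_congr fun h => ?_
    rw [mul_assoc, ← ENNReal.ofReal_mul' hp0.le, real_inner_smul_left]
    congr 2
    field_simp
  · refine Measurable.aemeasurable ?_
    refine ((measurable_norm.pow_const _).ennreal_ofReal).mul (Measurable.ennreal_ofReal ?_)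
    exact (by fun_prop : Continuous fun h : Rn n => -⟪‖p‖⁻¹ • p, h⟫).measurable


/-! ### The nonlocal energy -/

lemma grad_cont {n : ℕ} {f : Rn n → ℝ} (hf : ContDiff ℝ 1 f) : Continuous (gradient f) :=
  (InnerProductSpace.toDual ℝ (Rn n)).symm.continuous.comp (hf.continuous_fderiv one_ne_zero)

lemma line_bound {n : ℕ} {f : Rn n → ℝ} (hf : ContDiff ℝ 1 f) (x h : Rn n) :
    ENNReal.ofReal (f x - f (x + h)) ≤
      ∫⁻ t in Ioc (0:ℝ) 1, ENNReal.ofReal (-⟪gradient f (x + t • h), h⟫) := by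
  have hc : Continuous fun t : ℝ => -⟪gradient f (x + t • h), h⟫ := by
    have := grad_cont hf
    fun_prop
  have hd : ∀ t ∈ uIcc (0:ℝ) 1, HasDerivAt (fun t : ℝ => - f (x + t • h))
      (-⟪gradient f (x + t • h), h⟫) t := by
    intro t _
    rw [inner_gradient_left]
    have h1 : HasDerivAt (fun t : ℝ => x + t • h) h t := by
      simpa using ((hasDerivAt_id t).smul_const h).const_add x
    exact ((hf.differentiable one_ne_zero _).hasFDerivAt.comp_hasDerivAt t h1).neg
  have h2 := intervalIntegral.integral_eq_sub_of_hasDerivAt hd (hc.intervalIntegrable 0 1)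
  have e : f x - f (x + h) = ∫ t in (0:ℝ)..1, -⟪gradient f (x + t • h), h⟫ := by
    rw [h2]; simp; ring
  rw [e, intervalIntegral.integral_of_le zero_le_one]
  have hi : ∀ g : ℝ → ℝ, Continuous g → IntegrableOn g (Ioc (0:ℝ) 1) := fun g hg =>
    (hg.integrableOn_Icc (a := 0) (b := 1)).mono_set Ioc_subset_Icc_self
  calc ENNReal.ofReal (∫ t in Ioc (0:ℝ) 1, -⟪gradient f (x + t • h), h⟫)
      ≤ ENNReal.ofReal (∫ t in Ioc (0:ℝ) 1, max (-⟪gradient f (x + t • h), h⟫) 0) := by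
        refine ENNReal.ofReal_le_ofReal (integral_mono (hi _ hc)
          (hi _ (hc.max continuous_const)) fun t => le_max_left _ _)
    _ = ∫⁻ t in Ioc (0:ℝ) 1, ENNReal.ofReal (max (-⟪gradient f (x + t • h), h⟫) 0) :=
        ofReal_integral_eq_lintegral_ofReal (hi _ (hc.max continuous_const))
          (ae_of_all _ fun t => le_max_right _ _)
    _ = _ := by
        refine lintegral_congr fun t => ?_
        rw [ENNReal.ofReal_max]; simp

lemma near_bound {n : ℕ} {f : Rn n → ℝ} (hf : ContDiff ℝ 1 f) (Ω : Set (Rn n)) {r : ℝ}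
    (h : Rn n) (hh : ‖h‖ < r) :
    ∫⁻ x in thickening r Ω, ENNReal.ofReal (f x - f (x + h)) ≤
      ∫⁻ z in thickening (2 * r) Ω, ENNReal.ofReal (-⟪gradient f z, h⟫) := by
  have hgc := grad_cont hf
  set φ : Rn n → ℝ≥0∞ := fun z => ENNReal.ofReal (-⟪gradient f z, h⟫) with hφ
  have hφm : Measurable φ :=
    (by fun_prop : Continuous fun z => -⟪gradient f z, h⟫).measurable.ennreal_ofReal
  have hφm2 : Measurable (Function.uncurry fun (x : Rn n) (t : ℝ) => φ (x + t • h)) :=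
    (by fun_prop : Continuous fun q : Rn n × ℝ =>
      -⟪gradient f (q.1 + q.2 • h), h⟫).measurable.ennreal_ofReal
  calc ∫⁻ x in thickening r Ω, ENNReal.ofReal (f x - f (x + h))
      ≤ ∫⁻ x in thickening r Ω, ∫⁻ t in Ioc (0:ℝ) 1, φ (x + t • h) :=
        lintegral_mono fun x => line_bound hf x h
    _ = ∫⁻ t in Ioc (0:ℝ) 1, ∫⁻ x in thickening r Ω, φ (x + t • h) :=
        lintegral_lintegral_swap hφm2.aemeasurable
    _ ≤ ∫⁻ t in Ioc (0:ℝ) 1, ∫⁻ z in thickening (2 * r) Ω, φ z := by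
        refine setLIntegral_mono measurable_const fun t ht => ?_
        rw [← lintegral_indicator isOpen_thickening.measurableSet,
          ← lintegral_indicator isOpen_thickening.measurableSet,
          ← lintegral_add_right_eq_self ((thickening (2 * r) Ω).indicator φ) (t • h)]
        refine lintegral_mono fun x => ?_
        by_cases hx : x ∈ thickening r Ω
        · rw [indicator_of_mem hx]
          have : x + t • h ∈ thickening (2 * r) Ω := by
            rw [Metric.mem_thickening_iff] at hx ⊢
            obtain ⟨z, hz, hxz⟩ := hx
            refine ⟨z, hz, ?_⟩
            rw [dist_eq_norm] at hxz ⊢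
            have h1 : ‖t • h‖ ≤ ‖h‖ := by
              rw [norm_smul, Real.norm_of_nonneg ht.1.le]
              exact mul_le_of_le_one_left (norm_nonneg _) ht.2
            calc ‖x + t • h - z‖ = ‖(x - z) + t • h‖ := by congr 1; abel
              _ ≤ ‖x - z‖ + ‖t • h‖ := norm_add_le _ _
              _ < 2 * r := by linarith
          rw [indicator_of_mem this]
        · rw [indicator_of_notMem hx]; exact zero_le
    _ = _ := by simp

/-- pairs with at least one point in `Ω` -/
def Wset {n : ℕ} (Ω : Set (Rn n)) : Set (Rn n × Rn n) := {q | q.1 ∈ Ω ∨ q.2 ∈ Ω}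

lemma Wset_meas {n : ℕ} {Ω : Set (Rn n)} (hΩ : IsOpen Ω) : MeasurableSet (Wset Ω) :=
  (measurable_fst hΩ.measurableSet).union (measurable_snd hΩ.measurableSet)

/-- the kernel -/
def kerS (n : ℕ) (s : ℝ) (h : Rn n) : ℝ≥0∞ := ENNReal.ofReal (‖h‖ ^ (-((n:ℝ) + 2 * s)))

lemma kerS_meas (n : ℕ) (s : ℝ) : Measurable (kerS n s) :=
  (measurable_norm.pow_const _).ennreal_ofReal

/-- functional version of the fractional perimeter -/
def Jfun (n : ℕ) (s : ℝ) (Ω : Set (Rn n)) (v : Rn n → ℝ) : ℝ≥0∞ :=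
  ∫⁻ q in Wset Ω, ENNReal.ofReal (v q.1 - v q.2) * kerS n s (q.1 - q.2)
    ∂((volume : Measure (Rn n)).prod volume)

lemma Jfun_bound {n : ℕ} (hn : 1 ≤ n) {s r : ℝ} (hs0 : 0 < s) (hs : s < 1/2) (hr : 0 < r)
    {Ω : Set (Rn n)} (hΩ : IsOpen Ω)
    {f v : Rn n → ℝ} (hf : ContDiff ℝ 1 f) (hv : Measurable v) (hv0 : ∀ x, 0 ≤ v x)
    (hv1 : ∀ x, v x ≤ 1) (hfv : ∀ x ∈ thickening (2 * r) Ω, v x = f x) :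
    Jfun n s Ω v ≤
      ENNReal.ofReal (√(n:ℝ) * bvol n * r ^ (1 - 2 * s) / (2 * (1 - 2 * s))) *
        (∫⁻ z in thickening (2 * r) Ω, ENNReal.ofReal ‖gradient f z‖) +
      2 * volume Ω * ENNReal.ofReal (n * bvol n * (r ^ (-(2 * s)) / (2 * s))) := by
  have hgc := grad_cont hf
  set U := thickening (2 * r) Ω with hU
  set F : Rn n × Rn n → ℝ≥0∞ := (Wset Ω).indicator
    (fun q => ENNReal.ofReal (v q.1 - v q.2) * kerS n s (q.1 - q.2)) with hF
  have hFm : Measurable F := by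
    refine Measurable.indicator ?_ (Wset_meas hΩ)
    refine Measurable.mul (Measurable.ennreal_ofReal ?_)
      ((kerS_meas n s).comp (measurable_fst.sub measurable_snd))
    exact (hv.comp measurable_fst).sub (hv.comp measurable_snd)
  have hsh : Measurable fun z : Rn n × Rn n => (z.1, z.1 + z.2) :=
    measurable_fst.prodMk (measurable_fst.add measurable_snd)
  have h1 : Jfun n s Ω v = ∫⁻ h, ∫⁻ x, F (x, x + h) := by
    unfold Jfun
    rw [← lintegral_indicator (Wset_meas hΩ), lintegral_prod _ hFm.aemeasurable,
      ← lintegral_lintegral_swap (f := fun x h => F (x, x + h)) (hFm.comp hsh).aemeasurable]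
    refine lintegral_congr fun x => ?_
    exact (lintegral_add_left_eq_self (fun y => F (x, y)) x).symm
  rw [h1, ← lintegral_add_compl _ (measurableSet_ball (x := (0 : Rn n)) (ε := r))]
  refine add_le_add ?_ ?_
  · have hker : ∀ h : Rn n, ENNReal.ofReal (‖h‖ ^ (-((n:ℝ) + 2 * s))) = kerS n s h := fun _ => rfl
    calc ∫⁻ h in ball (0 : Rn n) r, ∫⁻ x, F (x, x + h)
        ≤ ∫⁻ h in ball (0 : Rn n) r, ∫⁻ z in U, kerS n s h *
            ENNReal.ofReal (-⟪gradient f z, h⟫) := by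
          refine setLIntegral_mono' measurableSet_ball fun h hh => ?_
          have hh' : ‖h‖ < r := by simpa using hh
          rw [lintegral_const_mul' _ _ (show kerS n s h ≠ ⊤ from ENNReal.ofReal_ne_top)]
          refine le_trans ?_ (mul_le_mul_right (near_bound hf Ω h hh') _)
          rw [← lintegral_const_mul' _ _ (show kerS n s h ≠ ⊤ from ENNReal.ofReal_ne_top),
            ← lintegral_indicator isOpen_thickening.measurableSet]
          refine lintegral_mono fun x => ?_
          by_cases hx : (x, x + h) ∈ Wset Ω
          · have hx1 : x ∈ thickening r Ω := by
              rw [Metric.mem_thickening_iff]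
              rcases hx with hx | hx
              · exact ⟨x, hx, by simpa using hr⟩
              · exact ⟨x + h, hx, by simpa using hh'⟩
            have hx2 : x ∈ U := thickening_mono (by linarith) _ hx1
            have hx3 : x + h ∈ U := by
              rw [hU, Metric.mem_thickening_iff]
              rcases hx with hx | hx
              · exact ⟨x, hx, by rw [dist_comm]; simp; linarith⟩
              · exact ⟨x + h, hx, by simpa using hr⟩
            rw [hF, indicator_of_mem hx, indicator_of_mem hx1]
            simp only
            rw [hfv x hx2, hfv _ hx3, mul_comm]
            have : kerS n s (x - (x + h)) = kerS n s h := by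
              unfold kerS; congr 2; rw [← norm_neg]; congr 1; abel
            rw [this]
          · rw [hF, indicator_of_notMem hx]; exact zero_le
      _ = ∫⁻ z in U, ∫⁻ h in ball (0 : Rn n) r, kerS n s h *
            ENNReal.ofReal (-⟪gradient f z, h⟫) := by
          refine lintegral_lintegral_swap (Measurable.aemeasurable ?_)
          refine ((kerS_meas n s).comp measurable_fst).mul (Measurable.ennreal_ofReal ?_)
          exact (by fun_prop : Continuous fun q : Rn n × Rn n =>
            -⟪gradient f q.2, q.1⟫).measurable
      _ ≤ ∫⁻ z in U, ENNReal.ofReal (√(n:ℝ) * bvol n * r ^ (1 - 2 * s) / (2 * (1 - 2 * s))) *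
            ENNReal.ofReal ‖gradient f z‖ :=
          lintegral_mono fun z => theta_bound hn hs hr _
      _ = _ := lintegral_const_mul' _ _ ENNReal.ofReal_ne_top
  · rw [← radial_far hn hs0 hr]
    change _ ≤ 2 * volume Ω * ∫⁻ h in (ball (0 : Rn n) r)ᶜ, kerS n s h
    rw [← lintegral_const_mul _ (kerS_meas n s)]
    refine lintegral_mono fun h => ?_
    calc ∫⁻ x, F (x, x + h) ≤ ∫⁻ x, (Ω.indicator (fun _ => kerS n s h) x +
          Ω.indicator (fun _ => kerS n s h) (x + h)) := by
          refine lintegral_mono fun x => ?_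
          by_cases hx : (x, x + h) ∈ Wset Ω
          · rw [hF, indicator_of_mem hx]
            simp only
            have : kerS n s (x - (x + h)) = kerS n s h := by
              unfold kerS; congr 2; rw [← norm_neg]; congr 1; abel
            rw [this]
            have h2 : ENNReal.ofReal (v x - v (x + h)) * kerS n s h ≤ kerS n s h := by
              refine mul_le_of_le_one_left' ?_
              rw [ENNReal.ofReal_le_one]
              linarith [hv0 (x + h), hv1 x]
            refine h2.trans ?_
            rcases hx with hx | hx
            · rw [indicator_of_mem (by exact hx)]; exact le_self_add
            · rw [indicator_of_mem (s := Ω) (a := x + h) (by exact hx)]; exact le_add_self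
          · rw [hF, indicator_of_notMem hx]; exact zero_le
      _ = 2 * volume Ω * kerS n s h := by
          have hm : Measurable (Ω.indicator (fun _ : Rn n => kerS n s h)) :=
            measurable_const.indicator hΩ.measurableSet
          rw [lintegral_add_left hm, lintegral_add_right_eq_self
            (Ω.indicator (fun _ : Rn n => kerS n s h)) h,
            lintegral_indicator hΩ.measurableSet, setLIntegral_const]
          ring

lemma PerS_eq {n : ℕ} (s : ℝ) {Ω F : Set (Rn n)} (hΩ : IsOpen Ω) (hF : MeasurableSet F) :
    PerS n s F Ω = ∫⁻ q in (F ×ˢ Fᶜ) ∩ Wset Ω, kerS n s (q.1 - q.2)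
      ∂((volume : Measure (Rn n)).prod volume) := by
  have hIs : ∀ A B : Set (Rn n), Is n s A B = ∫⁻ q in A ×ˢ B, kerS n s (q.1 - q.2)
      ∂((volume : Measure (Rn n)).prod volume) := by
    intro A B
    rw [← Measure.prod_restrict, lintegral_prod]
    · rfl
    · exact ((kerS_meas n s).comp (measurable_fst.sub measurable_snd)).aemeasurable
  have hΩm := hΩ.measurableSet
  unfold PerS PerSInt PerSExt
  rw [hIs, hIs, hIs, ← lintegral_union, ← lintegral_union]
  · congr 2
    ext ⟨x, y⟩
    simp only [Wset, mem_union, mem_prod, mem_inter_iff, Set.mem_sdiff, mem_compl_iff, mem_ofPred_eq]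
    tauto
  · exact ((hF.diff hΩm).prod (hΩm.diff hF)).union ((hF.inter hΩm).prod (hΩm.compl.diff hF))
  · rw [Set.disjoint_left]
    rintro ⟨x, y⟩
    simp only [mem_union, mem_prod, mem_inter_iff, Set.mem_sdiff, mem_compl_iff]
    tauto
  · exact (hF.inter hΩm).prod (hΩm.compl.diff hF)
  · rw [Set.disjoint_left]
    rintro ⟨x, y⟩
    simp only [mem_prod, mem_inter_iff, Set.mem_sdiff, mem_compl_iff]
    tauto

lemma coarea_choice {n : ℕ} (s : ℝ) {Ω : Set (Rn n)} (hΩ : IsOpen Ω) {v : Rn n → ℝ}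
    (hv : Measurable v) :
    ∃ t ∈ Ioo (1/8 : ℝ) (7/8), PerS n s {x | t < v x} Ω ≤ ENNReal.ofReal (4/3) * Jfun n s Ω v := by
  have hvt : ∀ t, MeasurableSet {x | t < v x} := fun t => measurableSet_lt measurable_const hv
  set k : Rn n × Rn n → ℝ≥0∞ := fun q => kerS n s (q.1 - q.2) with hk
  have hkm : Measurable k := (kerS_meas n s).comp (measurable_fst.sub measurable_snd)
  set S : Set (ℝ × (Rn n × Rn n)) := {p | p.1 < v p.2.1 ∧ v p.2.2 ≤ p.1} with hS
  have hSm : MeasurableSet S :=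
    (measurableSet_lt measurable_fst (hv.comp (measurable_fst.comp measurable_snd))).inter
      (measurableSet_le (hv.comp (measurable_snd.comp measurable_snd)) measurable_fst)
  set Φ : ℝ × (Rn n × Rn n) → ℝ≥0∞ := S.indicator (fun p => k p.2) with hΦ
  have hΦm : Measurable Φ := (hkm.comp measurable_snd).indicator hSm
  have hper : ∀ t, PerS n s {x | t < v x} Ω = ∫⁻ q in Wset Ω, Φ (t, q)
      ∂((volume : Measure (Rn n)).prod volume) := by
    intro t
    rw [PerS_eq s hΩ (hvt t), ← Measure.restrict_restrict ((hvt t).prod (hvt t).compl),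
      ← lintegral_indicator ((hvt t).prod (hvt t).compl)]
    refine lintegral_congr fun q => ?_
    by_cases hq : (t, q) ∈ S
    · rw [hΦ, indicator_of_mem hq, indicator_of_mem]
      exact ⟨hq.1, by simpa using hq.2⟩
    · rw [hΦ, indicator_of_notMem hq, indicator_of_notMem]
      intro h
      exact hq ⟨h.1, by simpa using h.2⟩
  have hmeas : Measurable fun t => PerS n s {x | t < v x} Ω := by
    simp_rw [hper]
    exact hΦm.lintegral_prod_right'
  have hvol : volume (Ioo (1/8 : ℝ) (7/8)) = ENNReal.ofReal (3/4) := by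
    rw [Real.volume_Ioo]; norm_num
  obtain ⟨t, ht, hle⟩ := exists_le_setLAverage (μ := volume) (s := Ioo (1/8 : ℝ) (7/8))
    (by rw [hvol]; simp) (by rw [hvol]; simp) hmeas.aemeasurable
  refine ⟨t, ht, hle.trans ?_⟩
  rw [setLAverage_eq, hvol, ENNReal.div_eq_inv_mul, ← ENNReal.ofReal_inv_of_pos (by norm_num)]
  have : ((3:ℝ)/4)⁻¹ = 4/3 := by norm_num
  rw [this]
  refine mul_le_mul_right ?_ _
  simp_rw [hper]
  rw [lintegral_lintegral_swap (f := fun t q => Φ (t, q)) hΦm.aemeasurable]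
  unfold Jfun
  refine lintegral_mono fun q => ?_
  calc ∫⁻ t in Ioo (1/8 : ℝ) (7/8), Φ (t, q) ≤ ∫⁻ t, Φ (t, q) := setLIntegral_le_lintegral _ _
    _ = ∫⁻ t, (Ico (v q.2) (v q.1)).indicator (fun _ => k q) t := by
        refine lintegral_congr fun t => ?_
        by_cases ht : t ∈ Ico (v q.2) (v q.1)
        · rw [indicator_of_mem ht, hΦ, indicator_of_mem (show (t, q) ∈ S from ⟨ht.2, ht.1⟩)]
        · rw [indicator_of_notMem ht, hΦ, indicator_of_notMem (fun h => ht ⟨h.2, h.1⟩)]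
    _ = ENNReal.ofReal (v q.1 - v q.2) * kerS n s (q.1 - q.2) := by
        rw [lintegral_indicator measurableSet_Ico, setLIntegral_const, Real.volume_Ico, mul_comm]



/-! ### Integration by parts and duality -/

lemma fderiv_coord {n : ℕ} {φ : Rn n → Rn n} {x : Rn n} (h : DifferentiableAt ℝ φ x) (i : Fin n)
    (e : Rn n) : fderiv ℝ (fun y => φ y i) x e = fderiv ℝ φ x e i := by
  have := ((EuclideanSpace.proj i : Rn n →L[ℝ] ℝ).hasFDerivAt.comp x
    h.hasFDerivAt).fderiv
  change fderiv ℝ (⇑(EuclideanSpace.proj i : Rn n →L[ℝ] ℝ) ∘ φ) x e = _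
  rw [this]; rfl

lemma divg_cont {n : ℕ} {φ : Rn n → Rn n} (h : ContDiff ℝ 1 φ) : Continuous (divg n φ) := by
  have := h.continuous_fderiv one_ne_zero
  unfold divg
  fun_prop

lemma divg_zero_of_notMem {n : ℕ} {φ : Rn n → Rn n} {x : Rn n} (hx : x ∉ tsupport φ) :
    divg n φ x = 0 := by
  have : fderiv ℝ φ x = 0 := by
    by_contra h
    exact hx (support_fderiv_subset ℝ h)
  simp [divg, this]

lemma divg_cpt {n : ℕ} {φ : Rn n → Rn n} (h : HasCompactSupport φ) :
    HasCompactSupport (divg n φ) :=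
  HasCompactSupport.intro h fun _ hx => divg_zero_of_notMem hx

lemma sum_single_eq {n : ℕ} (A : Rn n →L[ℝ] ℝ) (w : Rn n) :
    A w = ∑ i, w i * A (EuclideanSpace.single i 1) := by
  conv_lhs => rw [← (EuclideanSpace.basisFun (Fin n) ℝ).sum_repr w]
  rw [map_sum]
  simp [EuclideanSpace.basisFun_apply]

lemma ibp {n : ℕ} {f : Rn n → ℝ} {φ : Rn n → Rn n} (hf : ContDiff ℝ 1 f) (hφ : ContDiff ℝ 1 φ)
    (hc : HasCompactSupport φ) :
    ∫ x, f x * divg n φ x = - ∫ x, fderiv ℝ f x (φ x) := by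
  have hfc := hf.continuous
  have hfc' := hf.continuous_fderiv one_ne_zero
  have hφc := hφ.continuous
  have hφc' := hφ.continuous_fderiv one_ne_zero
  have hz : ∀ x, x ∉ tsupport φ → φ x = 0 := fun x hx => image_eq_zero_of_notMem_tsupport hx
  have hz' : ∀ x, x ∉ tsupport φ → fderiv ℝ φ x = 0 := by
    intro x hx
    by_contra h
    exact hx (support_fderiv_subset ℝ h)
  have e1 : ∀ x, f x * divg n φ x = ∑ i, f x *
      fderiv ℝ (fun y => φ y i) x (EuclideanSpace.single i 1) := by
    intro x
    rw [divg, Finset.mul_sum]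
    refine Finset.sum_congr rfl fun i _ => ?_
    rw [fderiv_coord (hφ.differentiable one_ne_zero x)]
  have e2 : ∀ x, fderiv ℝ f x (φ x) = ∑ i,
      fderiv ℝ f x (EuclideanSpace.single i 1) * φ x i := by
    intro x
    rw [sum_single_eq]
    exact Finset.sum_congr rfl fun i _ => mul_comm _ _
  have i1 : ∀ i, Integrable fun x => f x *
      fderiv ℝ (fun y => φ y i) x (EuclideanSpace.single i 1) := by
    intro i
    have : (fun x => f x * fderiv ℝ (fun y => φ y i) x (EuclideanSpace.single i 1)) =
        fun x => f x * fderiv ℝ φ x (EuclideanSpace.single i 1) i := by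
      funext x; rw [fderiv_coord (hφ.differentiable one_ne_zero x)]
    rw [this]
    refine Continuous.integrable_of_hasCompactSupport (by fun_prop) ?_
    exact HasCompactSupport.intro hc fun x hx => by simp [hz' x hx]
  have i2 : ∀ i, Integrable fun x => fderiv ℝ f x (EuclideanSpace.single i 1) * φ x i := by
    intro i
    refine Continuous.integrable_of_hasCompactSupport (by fun_prop) ?_
    exact HasCompactSupport.intro hc fun x hx => by simp [hz x hx]
  have i3 : ∀ i, Integrable fun x => f x * φ x i := by
    intro i
    refine Continuous.integrable_of_hasCompactSupport (by fun_prop) ?_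
    exact HasCompactSupport.intro hc fun x hx => by simp [hz x hx]
  simp_rw [e1, e2]
  rw [integral_finsetSum _ fun i _ => i1 i, integral_finsetSum _ fun i _ => i2 i,
    ← Finset.sum_neg_distrib]
  refine Finset.sum_congr rfl fun i _ => ?_
  refine integral_mul_fderiv_eq_neg_fderiv_mul_of_integrable (i2 i) (i1 i) (i3 i)
    (fun x _ => hf.differentiable one_ne_zero x) (fun x _ => ?_)
  have h := hφ.differentiable one_ne_zero x
  exact (EuclideanSpace.proj i : Rn n →L[ℝ] ℝ).differentiableAt.comp x h

lemma cutoff {n : ℕ} {K U : Set (Rn n)} (hK : IsCompact K) (hU : IsOpen U) (hKU : K ⊆ U) :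
    ∃ χ : Rn n → ℝ, ContDiff ℝ 1 χ ∧ HasCompactSupport χ ∧ tsupport χ ⊆ U ∧
      (∀ x ∈ K, χ x = 1) ∧ (∀ x, 0 ≤ χ x) ∧ (∀ x, χ x ≤ 1) := by
  obtain ⟨V, hV, hKV, hVU, hVc⟩ := exists_open_between_and_isCompact_closure hK hU hKU
  obtain ⟨f, h0, h1, h2⟩ := exists_contMDiffMap_zero_one_of_isClosed (n := 1)
    (modelWithCornersSelf ℝ (Rn n)) hV.isClosed_compl hK.isClosed
    (disjoint_compl_left_iff_subset.2 hKV)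
  have hs : tsupport f ⊆ closure V := by
    refine closure_mono fun x hx => ?_
    by_contra hxV
    exact hx (h0 hxV)
  exact ⟨f, f.contMDiff.contDiff, hVc.of_isClosed_subset (isClosed_tsupport _) hs,
    hs.trans hVU, fun x hx => h1 hx, fun x => (h2 x).1, fun x => (h2 x).2⟩

lemma duality {n : ℕ} {f : Rn n → ℝ} (hf : ContDiff ℝ 2 f) {U K : Set (Rn n)} (hU : IsOpen U)
    (hK : IsCompact K) (hKU : K ⊆ U) {B : ℝ}
    (hB : ∀ φ : Rn n → Rn n, ContDiff ℝ 1 φ → HasCompactSupport φ → tsupport φ ⊆ U →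
      (∀ x, ‖φ x‖ ≤ 1) → ∫ x, f x * divg n φ x ≤ B) :
    ∫⁻ x in K, ENNReal.ofReal ‖gradient f x‖ ≤ ENNReal.ofReal B := by
  obtain ⟨χ, hχ, hχc, hχs, hχ1, hχ0, hχle⟩ := cutoff hK hU hKU
  have hf1 : ContDiff ℝ 1 f := hf.of_le (by norm_num)
  have hG : ContDiff ℝ 1 (gradient f) := by
    have : ContDiff ℝ 1 (fderiv ℝ f) := hf.fderiv_right (by norm_num)
    exact (InnerProductSpace.toDual ℝ (Rn n)).symm.contDiff.comp this
  have hGc := hG.continuous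
  have hχcont := hχ.continuous
  have key : ∀ κ : ℝ, 0 < κ → ∫ x in K, ‖gradient f x‖ ≤ B + κ * volume.real K := by
    intro κ hκ
    have hpos : ∀ x, 0 < ‖gradient f x‖ ^ 2 + κ ^ 2 := fun x => by positivity
    set D : Rn n → ℝ := fun x => √(‖gradient f x‖ ^ 2 + κ ^ 2) with hD
    have hDpos : ∀ x, 0 < D x := fun x => Real.sqrt_pos.2 (hpos x)
    have hDsq : ∀ x, D x ^ 2 = ‖gradient f x‖ ^ 2 + κ ^ 2 := fun x => Real.sq_sqrt (hpos x).le
    have hDC : ContDiff ℝ 1 D :=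
      ((hG.norm_sq ℝ).add contDiff_const).sqrt fun x => (hpos x).ne'
    have hDcont := hDC.continuous
    have hDge : ∀ x, ‖gradient f x‖ ≤ D x := fun x =>
      Real.le_sqrt_of_sq_le (by nlinarith)
    have hDκ : ∀ x, κ ≤ D x := fun x => Real.le_sqrt_of_sq_le (by nlinarith [norm_nonneg (gradient f x)])
    set φ : Rn n → Rn n := fun x => (-(χ x / D x)) • gradient f x with hφ
    have hφC : ContDiff ℝ 1 φ := ((hχ.div hDC fun x => (hDpos x).ne').neg).smul hG
    have hφs : tsupport φ ⊆ tsupport χ := by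
      refine closure_mono fun x hx hx' => hx ?_
      simp [hφ, hx']
    have hφc : HasCompactSupport φ := hχc.of_isClosed_subset (isClosed_tsupport _) hφs
    have hφ1 : ∀ x, ‖φ x‖ ≤ 1 := by
      intro x
      rw [hφ, norm_smul, norm_neg, Real.norm_of_nonneg (div_nonneg (hχ0 x) (hDpos x).le),
        div_mul_eq_mul_div, div_le_one (hDpos x)]
      calc χ x * ‖gradient f x‖ ≤ 1 * ‖gradient f x‖ := by gcongr; exact hχle x
        _ ≤ D x := by rw [one_mul]; exact hDge x
    have h1 := hB φ hφC hφc (hφs.trans hχs) hφ1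
    rw [ibp hf1 hφC hφc, ← integral_neg] at h1
    have e : ∀ x, -(fderiv ℝ f x (φ x)) = χ x * (‖gradient f x‖ ^ 2 / D x) := by
      intro x
      rw [← inner_gradient_left, hφ, inner_smul_right, real_inner_self_eq_norm_sq]
      ring
    simp_rw [e] at h1
    have hcont : Continuous fun x => χ x * (‖gradient f x‖ ^ 2 / D x) :=
      hχcont.mul ((hGc.norm.pow 2).div hDcont fun x => (hDpos x).ne')
    have hint : Integrable fun x => χ x * (‖gradient f x‖ ^ 2 / D x) :=
      hcont.integrable_of_hasCompactSupport hχc.mul_right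
    have h2 : ∫ x in K, (‖gradient f x‖ - κ) ≤ ∫ x in K, χ x * (‖gradient f x‖ ^ 2 / D x) := by
      refine setIntegral_mono_on ((hGc.norm.sub continuous_const).continuousOn.integrableOn_compact hK)
        hint.integrableOn hK.measurableSet fun x hx => ?_
      rw [hχ1 x hx, one_mul, le_div_iff₀ (hDpos x)]
      nlinarith [hDsq x, hDge x, hDκ x, hDpos x, norm_nonneg (gradient f x)]
    have h3 : ∫ x in K, χ x * (‖gradient f x‖ ^ 2 / D x) ≤ ∫ x, χ x * (‖gradient f x‖ ^ 2 / D x) :=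
      setIntegral_le_integral hint (ae_of_all _ fun x =>
        mul_nonneg (hχ0 x) (div_nonneg (by positivity) (hDpos x).le))
    rw [integral_sub (hGc.norm.continuousOn.integrableOn_compact hK)
      (continuous_const.continuousOn.integrableOn_compact hK), setIntegral_const, smul_eq_mul] at h2
    linarith [mul_comm κ (volume.real K)]
  have hlim : ∫ x in K, ‖gradient f x‖ ≤ B := by
    have ht : Tendsto (fun κ : ℝ => B + κ * volume.real K) (𝓝[>] 0) (𝓝 (B + 0 * volume.real K)) :=
      ((by fun_prop : Continuous fun κ : ℝ => B + κ * volume.real K).tendsto 0).mono_left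
        nhdsWithin_le_nhds
    rw [zero_mul, add_zero] at ht
    refine ge_of_tendsto ht ?_
    filter_upwards [self_mem_nhdsWithin] with κ hκ using key κ hκ
  rw [← ofReal_integral_eq_lintegral_ofReal (hGc.norm.continuousOn.integrableOn_compact hK)
    (ae_of_all _ fun x => norm_nonneg _)]
  exact ENNReal.ofReal_le_ofReal hlim


/-! ### Mollification -/

/-- mollification of `g` with the kernel `η` -/
def mol {n : ℕ} (η g : Rn n → ℝ) (x : Rn n) : ℝ := ∫ h, η h * g (x + h)

lemma mol_int {n : ℕ} {η g : Rn n → ℝ} (hη : Continuous η) (hηc : HasCompactSupport η)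
    (hg : Measurable g) (hg1 : ∀ x, ‖g x‖ ≤ 1) (x : Rn n) :
    Integrable fun h => η h * g (x + h) := by
  have h1 : Integrable η := hη.integrable_of_hasCompactSupport hηc
  refine h1.mono (h1.aestronglyMeasurable.mul
    (hg.comp (measurable_const_add x)).aestronglyMeasurable) (ae_of_all _ fun h => ?_)
  rw [norm_mul]
  exact mul_le_of_le_one_right (norm_nonneg _) (hg1 _)

lemma mol_contDiff {n : ℕ} {η g : Rn n → ℝ} (hη : ContDiff ℝ 2 η) (hηc : HasCompactSupport η)
    (hg : LocallyIntegrable g) : ContDiff ℝ 2 (mol η g) := by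
  have h1 : ContDiff ℝ 2 (fun z => η (-z)) := hη.comp contDiff_neg
  have h2 : HasCompactSupport (fun z => η (-z)) := hηc.comp_homeomorph (Homeomorph.neg (Rn n))
  have h3 := h2.contDiff_convolution_right (n := 2) (ContinuousLinearMap.lsmul ℝ ℝ) hg h1
  have e : mol η g = convolution g (fun z => η (-z)) (ContinuousLinearMap.lsmul ℝ ℝ) volume := by
    funext x
    rw [convolution_def, mol, ← integral_add_left_eq_self (μ := volume)
      (fun t => ContinuousLinearMap.lsmul ℝ ℝ (g t) (η (-(x - t)))) x]
    refine integral_congr_ae (ae_of_all _ fun h => ?_)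
    simp [mul_comm]
  rw [e]
  exact h3

lemma mol_nonneg {n : ℕ} {η g : Rn n → ℝ} (hη0 : ∀ h, 0 ≤ η h) (hg0 : ∀ x, 0 ≤ g x) (x : Rn n) :
    0 ≤ mol η g x := integral_nonneg fun h => mul_nonneg (hη0 h) (hg0 _)

lemma mol_le_one {n : ℕ} {η g : Rn n → ℝ} (hη : Continuous η) (hηc : HasCompactSupport η)
    (hη0 : ∀ h, 0 ≤ η h) (hη1 : ∫ h, η h = 1)
    (hg : Measurable g) (hg1 : ∀ x, ‖g x‖ ≤ 1) (x : Rn n) :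
    mol η g x ≤ 1 := by
  rw [← hη1]
  refine integral_mono (mol_int hη hηc hg hg1 x) (hη.integrable_of_hasCompactSupport hηc)
    fun h => mul_le_of_le_one_right (hη0 h) ((le_abs_self _).trans (hg1 _))

lemma mol_L1 {n : ℕ} {η : Rn n → ℝ} {G : Set (Rn n)} (hη : Continuous η)
    (hηc : HasCompactSupport η)
    (hη0 : ∀ h, 0 ≤ η h) (hη1 : ∫ h, η h = 1) (hG : MeasurableSet G) {ρ : ℝ} {τ : ℝ≥0∞}
    (hρ : ∀ h, η h ≠ 0 → ‖h‖ ≤ ρ)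
    (hτ : ∀ h : Rn n, ‖h‖ ≤ ρ → volume (symmDiff ((fun x => x + h) ⁻¹' G) G) ≤ τ) :
    ∫⁻ x, ENNReal.ofReal |mol η (G.indicator 1) x - G.indicator 1 x| ≤ τ := by
  set g : Rn n → ℝ := G.indicator 1 with hgd
  have hg : Measurable g := measurable_one.indicator hG
  have hg1 : ∀ x, ‖g x‖ ≤ 1 := by
    intro x
    by_cases hx : x ∈ G <;> simp [hgd, hx]
  have hηi : Integrable η := hη.integrable_of_hasCompactSupport hηc
  have hm : Measurable (Function.uncurry fun (x h : Rn n) =>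
      ENNReal.ofReal (η h) * ENNReal.ofReal |g (x + h) - g x|) := by
    refine (hη.measurable.comp measurable_snd).ennreal_ofReal.mul (Measurable.ennreal_ofReal ?_)
    have : Measurable fun q : Rn n × Rn n => g (q.1 + q.2) - g q.1 :=
      (hg.comp (measurable_fst.add measurable_snd)).sub (hg.comp measurable_fst)
    exact this.abs
  calc ∫⁻ x, ENNReal.ofReal |mol η g x - g x|
      ≤ ∫⁻ x, ∫⁻ h, ENNReal.ofReal (η h) * ENNReal.ofReal |g (x + h) - g x| := by
        refine lintegral_mono fun x => ?_
        have e : mol η g x - g x = ∫ h, η h * (g (x + h) - g x) := by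
          simp_rw [mul_sub]
          rw [integral_sub (mol_int hη hηc hg hg1 x) (hηi.mul_const _), integral_mul_const, hη1,
            one_mul]
          rfl
        rw [e, ← Real.norm_eq_abs, ofReal_norm]
        refine (enorm_integral_le_lintegral_enorm _).trans (le_of_eq (lintegral_congr fun h => ?_))
        rw [← ENNReal.ofReal_mul (hη0 h), ← ofReal_norm, norm_mul, Real.norm_of_nonneg (hη0 h),
          Real.norm_eq_abs]
    _ = ∫⁻ h, ∫⁻ x, ENNReal.ofReal (η h) * ENNReal.ofReal |g (x + h) - g x| :=
        lintegral_lintegral_swap hm.aemeasurable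
    _ ≤ ∫⁻ h, ENNReal.ofReal (η h) * τ := by
        refine lintegral_mono fun h => ?_
        rw [lintegral_const_mul' _ _ ENNReal.ofReal_ne_top]
        by_cases h0 : η h = 0
        · simp [h0]
        refine mul_le_mul_right (le_trans (le_of_eq ?_) (hτ h (hρ h h0))) _
        have hsm : MeasurableSet (symmDiff ((fun x => x + h) ⁻¹' G) G) :=
          (measurable_add_const h hG).symmDiff hG
        rw [← lintegral_indicator_one hsm]
        refine lintegral_congr fun x => ?_
        by_cases h1 : x + h ∈ G <;> by_cases h2 : x ∈ G <;>
          simp [hgd, h1, h2, Set.mem_symmDiff, indicator]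
    _ = τ := by
        rw [lintegral_mul_const _ hη.measurable.ennreal_ofReal,
          ← ofReal_integral_eq_lintegral_ofReal hηi (ae_of_all _ hη0), hη1]
        simp

/-- vector mollification -/
def vmol {n : ℕ} (η : Rn n → ℝ) (w : Rn n → Rn n) : Rn n → Rn n :=
  convolution η w (ContinuousLinearMap.lsmul ℝ ℝ) volume

lemma vmol_apply {n : ℕ} (η : Rn n → ℝ) (w : Rn n → Rn n) (y : Rn n) :
    vmol η w y = ∫ h, η h • w (y - h) := by
  rw [vmol, convolution_def]; rfl

lemma vmol_contDiff {n : ℕ} {η : Rn n → ℝ} {w : Rn n → Rn n} (hη : Integrable η)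
    (hw : ContDiff ℝ 1 w) (hwc : HasCompactSupport w) : ContDiff ℝ 1 (vmol η w) :=
  hwc.contDiff_convolution_right (n := 1) _ hη.locallyIntegrable hw

lemma vmol_divg {n : ℕ} {η : Rn n → ℝ} {w : Rn n → Rn n} (hη : Integrable η)
    (hw : ContDiff ℝ 1 w) (hwc : HasCompactSupport w) (y : Rn n) :
    divg n (vmol η w) y = ∫ h, η h * divg n w (y - h) := by
  have hd := (hwc.hasFDerivAt_convolution_right (ContinuousLinearMap.lsmul ℝ ℝ)
    hη.locallyIntegrable hw y).fderiv
  have hwf := hw.continuous_fderiv one_ne_zero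
  have hi : ∀ e : Rn n, Integrable fun h => η h • fderiv ℝ w (y - h) e := by
    intro e
    have := (hwc.fderiv_apply ℝ e).convolutionExists_right (ContinuousLinearMap.lsmul ℝ ℝ)
      hη.locallyIntegrable (by fun_prop : Continuous fun x => fderiv ℝ w x e) y
    exact this
  have hc : ∀ (e : Rn n) (i : Fin n), Integrable fun h => η h * fderiv ℝ w (y - h) e i := by
    intro e i
    have := (EuclideanSpace.proj i : Rn n →L[ℝ] ℝ).integrable_comp (hi e)
    exact this
  unfold divg
  rw [vmol, hd]
  simp_rw [Finset.mul_sum]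
  rw [integral_finsetSum _ fun i _ => hc _ i]
  refine Finset.sum_congr rfl fun i _ => ?_
  rw [convolution_precompR_apply _ hη.locallyIntegrable (hwc.fderiv ℝ) hwf, convolution_def]
  exact ((EuclideanSpace.proj i : Rn n →L[ℝ] ℝ).integral_comp_comm (hi _)).symm

open scoped Pointwise in
lemma vmol_support {n : ℕ} {η : Rn n → ℝ} {w : Rn n → Rn n} {S : Set (Rn n)} (hS : IsCompact S)
    (hηS : Function.support η ⊆ S) (hwc : HasCompactSupport w) (y : Rn n)
    (hy : y ∈ tsupport (vmol η w)) : ∃ h ∈ S, ∃ x ∈ tsupport w, y = h + x := by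
  have hcl : IsClosed (S + tsupport w) := (hS.add hwc).isClosed
  have hsub : tsupport (vmol η w) ⊆ S + tsupport w := by
    refine closure_minimal ?_ hcl
    refine (support_convolution_subset _).trans ?_
    exact Set.add_subset_add hηS subset_closure
  obtain ⟨h, hh, x, hx, rfl⟩ := hsub hy
  exact ⟨h, hh, x, hx, rfl⟩

open scoped Pointwise in
lemma vmol_cpt {n : ℕ} {η : Rn n → ℝ} {w : Rn n → Rn n} {S : Set (Rn n)} (hS : IsCompact S)
    (hηS : Function.support η ⊆ S) (hwc : HasCompactSupport w) : HasCompactSupport (vmol η w) := by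
  refine (hS.add hwc).of_isClosed_subset (isClosed_tsupport _) fun y hy => ?_
  obtain ⟨h, hh, x, hx, rfl⟩ := vmol_support hS hηS hwc y hy
  exact Set.add_mem_add hh hx

lemma vmol_norm {n : ℕ} {η : Rn n → ℝ} {w : Rn n → Rn n} {ζ : Rn n → ℝ} {L ρ : ℝ} (hL : 0 ≤ L)
    (hηi : Integrable η) (hη0 : ∀ h, 0 ≤ η h) (hη1 : ∫ h, η h = 1)
    (hρ : ∀ h, η h ≠ 0 → ‖h‖ ≤ ρ) (hw : ∀ x, ‖w x‖ ≤ ζ x)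
    (hζ : ∀ x y, ζ x ≤ ζ y + L * ‖x - y‖) (y : Rn n) : ‖vmol η w y‖ ≤ ζ y + L * ρ := by
  rw [vmol_apply]
  have : ‖∫ h, η h • w (y - h)‖ ≤ ∫ h, η h * (ζ y + L * ρ) := by
    refine norm_integral_le_of_norm_le (hηi.mul_const _) (ae_of_all _ fun h => ?_)
    rw [norm_smul, Real.norm_of_nonneg (hη0 h)]
    by_cases h0 : η h = 0
    · simp [h0]
    refine mul_le_mul_of_nonneg_left ?_ (hη0 h)
    refine (hw _).trans ((hζ (y - h) y).trans ?_)
    have : ‖y - h - y‖ = ‖h‖ := by rw [← norm_neg h]; congr 1; abel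
    rw [this]
    gcongr
    exact hρ h h0
  rwa [integral_mul_const, hη1, one_mul] at this

lemma mol_fubini {n : ℕ} {η : Rn n → ℝ} {G : Set (Rn n)} {w : Rn n → Rn n} (hη : Continuous η)
    (hηc : HasCompactSupport η) (hG : MeasurableSet G) (hGf : volume G ≠ ⊤)
    (hw : ContDiff ℝ 1 w) (hwc : HasCompactSupport w) :
    ∫ x, mol η (G.indicator 1) x * divg n w x = ∫ x in G, divg n (vmol η w) x := by
  set g : Rn n → ℝ := G.indicator 1 with hgd
  have hg : Measurable g := measurable_one.indicator hG
  have hg1 : ∀ x, ‖g x‖ ≤ 1 := by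
    intro x
    by_cases hx : x ∈ G <;> simp [hgd, hx]
  have hηi : Integrable η := hη.integrable_of_hasCompactSupport hηc
  have hDc := divg_cont hw
  have hDi : Integrable (divg n w) := hDc.integrable_of_hasCompactSupport (divg_cpt hwc)
  obtain ⟨C, hC⟩ := (divg_cpt hwc).exists_bound_of_continuous hDc
  have hgi : Integrable g := by
    rw [hgd, integrable_indicator_iff hG]
    exact integrableOn_const hGf
  have i1 : Integrable (Function.uncurry fun (x h : Rn n) => η h * g (x + h) * divg n w x)
      (volume.prod volume) := by
    refine (hDi.mul_prod hηi).mono ?_ (ae_of_all _ ?_)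
    · refine Measurable.aestronglyMeasurable ?_
      exact ((hη.measurable.comp measurable_snd).mul
        (hg.comp (measurable_fst.add measurable_snd))).mul (hDc.measurable.comp measurable_fst)
    · rintro ⟨x, h⟩
      simp only [Function.uncurry_apply_pair, norm_mul]
      calc ‖η h‖ * ‖g (x + h)‖ * ‖divg n w x‖ ≤ ‖η h‖ * 1 * ‖divg n w x‖ := by
            gcongr; exact hg1 _
        _ = _ := by ring
  have i2 : Integrable (Function.uncurry fun (h y : Rn n) => η h * g y * divg n w (y - h))
      (volume.prod volume) := by
    refine ((hηi.mul_prod hgi).mul_const C).mono ?_ (ae_of_all _ ?_)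
    · refine Measurable.aestronglyMeasurable ?_
      exact ((hη.measurable.comp measurable_fst).mul
        (hg.comp measurable_snd)).mul (hDc.measurable.comp (measurable_snd.sub measurable_fst))
    · rintro ⟨h, y⟩
      simp only [Function.uncurry_apply_pair, norm_mul]
      gcongr
      exact (hC _).trans (le_abs_self _)
  calc ∫ x, mol η g x * divg n w x = ∫ x, ∫ h, η h * g (x + h) * divg n w x := by
        refine integral_congr_ae (ae_of_all _ fun x => ?_)
        simp only [mol]
        rw [integral_mul_const]
    _ = ∫ h, ∫ x, η h * g (x + h) * divg n w x := integral_integral_swap i1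
    _ = ∫ h, ∫ y, η h * g y * divg n w (y - h) := by
        refine integral_congr_ae (ae_of_all _ fun h => ?_)
        simp only
        rw [← integral_add_right_eq_self (fun y => η h * g y * divg n w (y - h)) h]
        simp
    _ = ∫ y, ∫ h, η h * g y * divg n w (y - h) := integral_integral_swap i2
    _ = ∫ y, G.indicator (divg n (vmol η w)) y := by
        refine integral_congr_ae (ae_of_all _ fun y => ?_)
        simp only
        by_cases hy : y ∈ G
        · rw [indicator_of_mem hy, vmol_divg hηi hw hwc]
          simp [hgd, hy]
        · simp [hgd, hy]
    _ = _ := integral_indicator hG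


/-! ### Smooth approximation up to the boundary -/

lemma fin_lower {ι : Type*} [Finite ι] (a : ι → ℝ) (ha : ∀ i, 0 < a i) :
    ∃ c > (0:ℝ), c ≤ 1 ∧ ∀ i, c ≤ a i := by
  have h : ∀ᶠ c in 𝓝[>] (0:ℝ), c ≤ 1 ∧ ∀ i, c ≤ a i := by
    refine Filter.Eventually.and ?_ (Filter.eventually_all.2 fun i => ?_)
    · exact nhdsWithin_le_nhds (Iic_mem_nhds one_pos)
    · exact nhdsWithin_le_nhds (Iic_mem_nhds (ha i))
  obtain ⟨c, h1, h2⟩ := (h.and self_mem_nhdsWithin).exists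
  exact ⟨c, h2, h1⟩

lemma pkg {n : ℕ} {Ω : Set (Rn n)} (hΩo : IsOpen Ω) (hΩb : Bornology.IsBounded Ω)
    (hlip : HasLipschitzBoundary n Ω) :
    ∃ (ι : Type) (_ : Fintype ι) (ζ : ι → Rn n → ℝ) (v : ι → Rn n) (c ε0 R0 L : ℝ),
      0 < c ∧ c ≤ 1 ∧ 0 < ε0 ∧ 0 < R0 ∧ 0 ≤ L ∧ (∀ i, ‖v i‖ ≤ 1) ∧
      (∀ i, ContDiff ℝ 2 (ζ i)) ∧ (∀ i x, 0 ≤ ζ i x) ∧ (∀ x, ∑ i, ζ i x ≤ 1) ∧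
      (∀ x ∈ thickening R0 Ω, ∑ i, ζ i x = 1) ∧
      (∀ i x, ‖fderiv ℝ (ζ i) x‖ ≤ L) ∧ (∀ i x y, ζ i x ≤ ζ i y + L * ‖x - y‖) ∧
      (∀ i ε, 0 < ε → ε < ε0 → ∀ x ∈ tsupport (ζ i), ∀ y ∈ Ω, ‖x - y‖ ≤ c * ε →
        ∀ z, ‖z - (x - ε • v i)‖ ≤ c * ε → z ∈ Ω) := by
  have hK : IsCompact (closure Ω) := hΩb.isCompact_closure
  have hgeo := fun x : closure Ω => aux_geo hΩo hlip x.1 x.2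
  choose r hr v hv c hc hc1 ε0 hε0 hgeo using hgeo
  obtain ⟨t, ht⟩ := hK.elim_finite_subcover (fun x : closure Ω => ball x.1 (r x))
    (fun x => isOpen_ball) (fun x hx => mem_iUnion.2 ⟨⟨x, hx⟩, mem_ball_self (hr _)⟩)
  obtain ⟨c', hc'0, hc'1, hc'⟩ := fin_lower (fun i : t => c i.1) fun i => hc _
  obtain ⟨e', he'0, -, he'⟩ := fin_lower (fun i : t => ε0 i.1) fun i => hε0 _
  have hcov : closure Ω ⊆ ⋃ i : t, ball i.1.1 (r i.1) := by
    intro x hx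
    obtain ⟨i, hi, hxi⟩ := mem_iUnion₂.1 (ht hx)
    exact mem_iUnion.2 ⟨⟨i, hi⟩, hxi⟩
  obtain ⟨R0, hR0, hR0s⟩ := hK.exists_cthickening_subset_open
    (isOpen_iUnion fun i : t => isOpen_ball) hcov
  obtain ⟨Z, hZ⟩ := SmoothPartitionOfUnity.exists_isSubordinate
    (modelWithCornersSelf ℝ (Rn n)) (isClosed_cthickening (δ := R0) (E := closure Ω))
    (fun i : t => ball i.1.1 (r i.1)) (fun i => isOpen_ball) hR0s
  have hZd : ∀ i, ContDiff ℝ 2 (Z i) := fun i =>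
    contDiff_infty.1 (Z i).contMDiff.contDiff 2
  have hZc : ∀ i, HasCompactSupport (Z i) := fun i =>
    (isCompact_closedBall i.1.1 (r i.1)).of_isClosed_subset (isClosed_tsupport _)
      ((hZ i).trans ball_subset_closedBall)
  have hb : ∀ i, ∃ C, ∀ x, ‖fderiv ℝ (Z i) x‖ ≤ C := fun i =>
    ((hZc i).fderiv ℝ).exists_bound_of_continuous ((hZd i).continuous_fderiv two_ne_zero)
  choose C hC using hb
  have hL : ∀ i x, ‖fderiv ℝ (Z i) x‖ ≤ ∑ j, |C j| := fun i x =>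
    ((hC i x).trans (le_abs_self _)).trans
      (Finset.single_le_sum (f := fun j => |C j|) (fun j _ => abs_nonneg _) (Finset.mem_univ i))
  -- transfer to a small type
  let e := Fintype.equivFin t
  refine ⟨Fin (Fintype.card t), inferInstance, fun i => Z (e.symm i), fun i => v (e.symm i).1,
    c', e', R0, ∑ j, |C j|, hc'0, hc'1, he'0, hR0, Finset.sum_nonneg fun j _ => abs_nonneg _,
    fun i => hv _, fun i => hZd _, fun i x => Z.nonneg _ _, ?_, ?_, fun i x => hL _ x, ?_, ?_⟩
  · intro x
    rw [Equiv.sum_comp e.symm (fun i => Z i x), ← finsum_eq_sum_of_fintype]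
    exact Z.sum_le_one x
  · intro x hx
    rw [Equiv.sum_comp e.symm (fun i => Z i x), ← finsum_eq_sum_of_fintype]
    refine Z.sum_eq_one ?_
    rw [cthickening_closure]
    exact thickening_subset_cthickening _ _ hx
  · intro i x y
    have := convex_univ.norm_image_sub_le_of_norm_fderiv_le (𝕜 := ℝ) (f := Z (e.symm i))
      (fun z _ => (hZd _).differentiable two_ne_zero z) (fun z _ => hL (e.symm i) z)
      (mem_univ y) (mem_univ x)
    have h2 := (le_abs_self _).trans this
    linarith
  · intro i ε hε hε' x hx y hy hxy z hz
    have h1 : c' * ε ≤ c (e.symm i).1 * ε := by gcongr; exact hc' _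
    exact hgeo (e.symm i).1 ε hε (hε'.trans_le (he' _)) x (hZ _ hx) y hy (hxy.trans h1) z
      (hz.trans h1)

lemma bump {n : ℕ} (a : Rn n) {ρ : ℝ} (hρ : 0 < ρ) :
    ∃ η : Rn n → ℝ, ContDiff ℝ 2 η ∧ HasCompactSupport η ∧ (∀ h, 0 ≤ η h) ∧ ∫ h, η h = 1 ∧
      Function.support η ⊆ closedBall a ρ := by
  let b : ContDiffBump a := ⟨ρ / 2, ρ, by positivity, by linarith⟩
  refine ⟨b.normed volume, b.contDiff_normed (n := 2), b.hasCompactSupport_normed,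
    b.nonneg_normed, b.integral_normed, ?_⟩
  rw [b.support_normed_eq]
  exact ball_subset_closedBall

lemma translate_small {n : ℕ} {G : Set (Rn n)} (hG : MeasurableSet G) (hGf : volume G ≠ ⊤)
    {τ : ℝ≥0∞} (hτ : 0 < τ) :
    ∃ ρ > (0:ℝ), ∀ h : Rn n, ‖h‖ ≤ ρ → volume (symmDiff ((fun x => x + h) ⁻¹' G) G) ≤ τ := by
  let F : Rn n → C(Rn n, Rn n) := fun h => ⟨fun x => x + h, by fun_prop⟩
  have hF : Continuous F :=
    ContinuousMap.continuous_of_continuous_uncurry _ (by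
      change Continuous fun p : Rn n × Rn n => p.2 + p.1
      fun_prop)
  have h := tendsto_measure_symmDiff_preimage_nhds_zero (μ := (volume : Measure (Rn n)))
    (ν := (volume : Measure (Rn n))) (hF.tendsto 0)
    (Eventually.of_forall fun h => measurePreserving_add_right volume h)
    (measurePreserving_add_right volume 0) hG.nullMeasurableSet hGf
  rw [ENNReal.tendsto_nhds_zero] at h
  obtain ⟨ρ, hρ, hb⟩ := Metric.nhds_basis_closedBall.eventually_iff.1 (h τ hτ)
  refine ⟨ρ, hρ, fun h hh => ?_⟩
  have := hb (show h ∈ closedBall 0 ρ by simpa using hh)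
  have e : (F 0 : Rn n → Rn n) ⁻¹' G = G := by
    ext x; simp [F]
  rw [e] at this
  exact this

lemma divg_smul {n : ℕ} {ζ : Rn n → ℝ} {φ : Rn n → Rn n} (hζ : ContDiff ℝ 1 ζ)
    (hφ : ContDiff ℝ 1 φ) (x : Rn n) :
    divg n (fun x => ζ x • φ x) x = ζ x * divg n φ x + fderiv ℝ ζ x (φ x) := by
  have h := ((hζ.differentiable one_ne_zero x).hasFDerivAt.smul
    (hφ.differentiable one_ne_zero x).hasFDerivAt).fderiv
  rw [sum_single_eq (fderiv ℝ ζ x) (φ x)]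
  unfold divg
  change ∑ i, fderiv ℝ (ζ • φ) x _ i = _
  rw [h, Finset.mul_sum, ← Finset.sum_add_distrib]
  refine Finset.sum_congr rfl fun i _ => ?_
  simp [mul_comm]

lemma per_scale {n : ℕ} {E Ω : Set (Rn n)} {p M : ℝ} (hp : 0 ≤ p) (hM : 0 < M)
    (hPer : Per n E Ω ≤ ENNReal.ofReal p) {ψ : Rn n → Rn n} (h1 : ContDiff ℝ 1 ψ)
    (h2 : HasCompactSupport ψ) (h3 : tsupport ψ ⊆ Ω) (h4 : ∀ x, ‖ψ x‖ ≤ M) :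
    ∫ x in E, divg n ψ x ≤ M * p := by
  have hs : tsupport (fun x => M⁻¹ • ψ x) ⊆ tsupport ψ := by
    refine closure_mono fun x hx hx' => hx ?_
    simp [hx']
  have key : ENNReal.ofReal (∫ x in E, divg n (fun x => M⁻¹ • ψ x) x) ≤ Per n E Ω := by
    unfold Per
    refine le_iSup_of_le (fun x => M⁻¹ • ψ x) (le_iSup_of_le (h1.const_smul _)
      (le_iSup_of_le ?_ (le_iSup_of_le (hs.trans h3) (le_iSup_of_le ?_ le_rfl))))
    · exact h2.of_isClosed_subset (isClosed_tsupport _) hs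
    · intro x
      rw [norm_smul, norm_inv, Real.norm_of_nonneg hM.le, inv_mul_le_one₀ hM]
      exact h4 x
  have e : ∀ x, divg n (fun x => M⁻¹ • ψ x) x = M⁻¹ * divg n ψ x := by
    intro x
    rw [divg_smul contDiff_const h1]
    simp
  simp_rw [e] at key
  rw [integral_const_mul] at key
  have := (ENNReal.ofReal_le_ofReal_iff hp).1 (key.trans hPer)
  rwa [inv_mul_le_iff₀ hM] at this


lemma divg_sum {n : ℕ} {ι : Type*} [Fintype ι] {ψ : ι → Rn n → Rn n}
    (h : ∀ i, ContDiff ℝ 1 (ψ i)) (x : Rn n) :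
    divg n (fun x => ∑ i, ψ i x) x = ∑ i, divg n (ψ i) x := by
  unfold divg
  rw [fderiv_fun_sum fun i _ => (h i).differentiable one_ne_zero x, Finset.sum_comm]
  refine Finset.sum_congr rfl fun i _ => ?_
  simp

lemma approx_test {n : ℕ} {E Ω : Set (Rn n)} (hE : MeasurableSet E) (hΩo : IsOpen Ω)
    (hΩb : Bornology.IsBounded Ω) {p : ℝ} (hp : 0 ≤ p) (hPer : Per n E Ω ≤ ENNReal.ofReal p)
    {ι : Type} [Fintype ι] {ζ : ι → Rn n → ℝ} {v : ι → Rn n} {c ε R0 L ρ τ : ℝ}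
    (hc : 0 < c) (hε : 0 < ε) (hL : 0 ≤ L) (hρ0 : 0 ≤ ρ)
    (hcR : c * ε ≤ R0) (hτ : 0 ≤ τ)
    (hζ : ∀ i, ContDiff ℝ 2 (ζ i)) (hζ0 : ∀ i x, 0 ≤ ζ i x) (hζ1 : ∀ x, ∑ i, ζ i x ≤ 1)
    (hζs : ∀ x ∈ thickening R0 Ω, ∑ i, ζ i x = 1)
    (hζL : ∀ i x, ‖fderiv ℝ (ζ i) x‖ ≤ L) (hζl : ∀ i x y, ζ i x ≤ ζ i y + L * ‖x - y‖)
    (hgeo : ∀ i, ∀ x ∈ tsupport (ζ i), ∀ y ∈ Ω, ‖x - y‖ ≤ c * ε →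
        ∀ z, ‖z - (x - ε • v i)‖ ≤ c * ε → z ∈ Ω)
    {η : ι → Rn n → ℝ} (hη : ∀ i, ContDiff ℝ 2 (η i)) (hηc : ∀ i, HasCompactSupport (η i))
    (hη0 : ∀ i h, 0 ≤ η i h) (hη1 : ∀ i, ∫ h, η i h = 1)
    (hηs : ∀ i, Function.support (η i) ⊆ closedBall (-(ε • v i)) (c * ε))
    (hηρ : ∀ i h, η i h ≠ 0 → ‖h‖ ≤ ρ)
    (hL1 : ∀ i, ∫⁻ x, ENNReal.ofReal |mol (η i) ((E ∩ Ω).indicator 1) x -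
      (E ∩ Ω).indicator 1 x| ≤ ENNReal.ofReal τ)
    {φ : Rn n → Rn n} (hφ : ContDiff ℝ 1 φ) (hφc : HasCompactSupport φ)
    (hφs : tsupport φ ⊆ thickening (c * ε) Ω) (hφ1 : ∀ x, ‖φ x‖ ≤ 1) :
    ∫ x, (∑ i, ζ i x * mol (η i) ((E ∩ Ω).indicator 1) x) * divg n φ x ≤
      (1 + Fintype.card ι * (L * ρ)) * p + Fintype.card ι * (L * τ) := by
  set G := E ∩ Ω with hGd
  have hG : MeasurableSet G := hE.inter hΩo.measurableSet
  have hGf : volume G ≠ ⊤ := ne_top_of_le_ne_top hΩb.measure_lt_top.ne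
    (measure_mono inter_subset_right)
  set g : Rn n → ℝ := G.indicator 1 with hgd
  have hg : Measurable g := measurable_one.indicator hG
  have hgi : Integrable g := by
    rw [hgd, integrable_indicator_iff hG]
    exact integrableOn_const hGf
  set u : ι → Rn n → ℝ := fun i => mol (η i) g with hu
  have huC : ∀ i, ContDiff ℝ 2 (u i) := fun i => mol_contDiff (hη i) (hηc i) hgi.locallyIntegrable
  have hζ' : ∀ i, ContDiff ℝ 1 (ζ i) := fun i => (hζ i).of_le (by norm_num)
  set w : ι → Rn n → Rn n := fun i x => ζ i x • φ x with hw
  have hwC : ∀ i, ContDiff ℝ 1 (w i) := fun i => (hζ' i).smul hφ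
  have hws : ∀ i, tsupport (w i) ⊆ tsupport (ζ i) ∩ tsupport φ := by
    intro i
    refine subset_inter (closure_mono fun x hx hx' => hx ?_) (closure_mono fun x hx hx' => hx ?_)
    · simp [hw, hx']
    · simp [hw, hx']
  have hwc : ∀ i, HasCompactSupport (w i) := fun i =>
    IsCompact.of_isClosed_subset hφc (isClosed_tsupport _) ((hws i).trans inter_subset_right)
  have hηi : ∀ i, Integrable (η i) := fun i =>
    (hη i).continuous.integrable_of_hasCompactSupport (hηc i)
  have hdz : ∀ x, ∑ i, fderiv ℝ (ζ i) x (φ x) = 0 := by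
    intro x
    by_cases hx : x ∈ tsupport φ
    · have hx' : x ∈ thickening R0 Ω := thickening_mono hcR _ (hφs hx)
      have h1 : (fun y => ∑ i, ζ i y) =ᶠ[𝓝 x] fun _ => (1:ℝ) := by
        filter_upwards [isOpen_thickening.mem_nhds hx'] with y hy using hζs y hy
      have h2 := h1.fderiv_eq (𝕜 := ℝ)
      rw [fderiv_fun_sum fun i _ => (hζ' i).differentiable one_ne_zero x] at h2
      have := congrArg (fun A : Rn n →L[ℝ] ℝ => A (φ x)) h2
      simpa using this
    · simp [image_eq_zero_of_notMem_tsupport hx]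
  have hpt : ∀ x, (∑ i, ζ i x * u i x) * divg n φ x =
      ∑ i, (u i x * divg n (w i) x - (u i x - g x) * fderiv ℝ (ζ i) x (φ x)) := by
    intro x
    have h1 : ∑ i, (-g x) * fderiv ℝ (ζ i) x (φ x) = 0 := by
      rw [← Finset.mul_sum, hdz, mul_zero]
    rw [Finset.sum_mul, ← sub_eq_zero, ← h1, ← Finset.sum_sub_distrib]
    refine Finset.sum_congr rfl fun i _ => ?_
    rw [hw, divg_smul (hζ' i) hφ]
    ring
  have i1 : ∀ i, Integrable fun x => u i x * divg n (w i) x := fun i =>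
    ((huC i).continuous.mul (divg_cont (hwC i))).integrable_of_hasCompactSupport
      (divg_cpt (hwc i)).mul_left
  have hui : ∀ i, Integrable fun x => u i x - g x := by
    intro i
    refine ⟨((huC i).continuous.measurable.sub hg).aestronglyMeasurable, ?_⟩
    rw [hasFiniteIntegral_iff_norm]
    exact (hL1 i).trans_lt ENNReal.ofReal_lt_top
  have hbd : ∀ i x, ‖(u i x - g x) * fderiv ℝ (ζ i) x (φ x)‖ ≤ ‖(u i x - g x) * L‖ := by
    intro i x
    rw [norm_mul, norm_mul, Real.norm_of_nonneg hL]
    gcongr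
    calc ‖fderiv ℝ (ζ i) x (φ x)‖ ≤ ‖fderiv ℝ (ζ i) x‖ * ‖φ x‖ := ContinuousLinearMap.le_opNorm _ _
      _ ≤ L * 1 := by gcongr; exacts [hζL i x, hφ1 x]
      _ = L := mul_one L
  have i2 : ∀ i, Integrable fun x => (u i x - g x) * fderiv ℝ (ζ i) x (φ x) := by
    intro i
    refine ((hui i).mul_const L).mono ((hui i).aestronglyMeasurable.mul ?_) (ae_of_all _ (hbd i))
    have := (hζ' i).continuous_fderiv one_ne_zero
    have := hφ.continuous
    exact (by fun_prop : Continuous fun x => fderiv ℝ (ζ i) x (φ x)).aestronglyMeasurable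
  have b2 : ∀ i, -(∫ x, (u i x - g x) * fderiv ℝ (ζ i) x (φ x)) ≤ L * τ := by
    intro i
    have h1 : ‖∫ x, (u i x - g x) * fderiv ℝ (ζ i) x (φ x)‖ ≤ ∫ x, ‖(u i x - g x) * L‖ :=
      norm_integral_le_of_norm_le ((hui i).mul_const L).norm (ae_of_all _ (hbd i))
    have h2 : ∫ x, ‖(u i x - g x) * L‖ = L * ∫ x, ‖u i x - g x‖ := by
      rw [← integral_const_mul]
      refine integral_congr_ae (ae_of_all _ fun x => ?_)
      simp only
      rw [norm_mul, Real.norm_of_nonneg hL, mul_comm]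
    have h3 : ∫ x, ‖u i x - g x‖ ≤ τ := by
      rw [← ENNReal.ofReal_le_ofReal_iff hτ,
        ofReal_integral_eq_lintegral_ofReal (hui i).norm (ae_of_all _ fun x => norm_nonneg _)]
      exact hL1 i
    have h4 := (neg_le_abs _).trans (h1.trans_eq h2)
    exact h4.trans (by gcongr)
  set ψ : Rn n → Rn n := fun x => ∑ i, vmol (η i) (w i) x with hψ
  have hψi : ∀ i, ContDiff ℝ 1 (vmol (η i) (w i)) := fun i =>
    vmol_contDiff (hηi i) (hwC i) (hwc i)
  have hψC : ContDiff ℝ 1 ψ := ContDiff.sum fun i _ => hψi i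
  have hψci : ∀ i, HasCompactSupport (vmol (η i) (w i)) := fun i =>
    vmol_cpt (isCompact_closedBall _ _) (hηs i) (hwc i)
  have hsup : tsupport ψ ⊆ ⋃ i, tsupport (vmol (η i) (w i)) := by
    refine closure_minimal (fun x hx => ?_) (isClosed_iUnion_of_finite fun i => isClosed_tsupport _)
    by_contra hx'
    simp only [mem_iUnion, not_exists] at hx'
    refine hx (Finset.sum_eq_zero fun i _ => image_eq_zero_of_notMem_tsupport (hx' i))
  have hψc : HasCompactSupport ψ :=
    (isCompact_iUnion fun i => hψci i).of_isClosed_subset (isClosed_tsupport _) hsup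
  have hψs : tsupport ψ ⊆ Ω := by
    intro z hz
    obtain ⟨i, hi⟩ := mem_iUnion.1 (hsup hz)
    obtain ⟨h, hh, x, hx, rfl⟩ := vmol_support (isCompact_closedBall _ _) (hηs i) (hwc i) z hi
    have hx2 := hws i hx
    obtain ⟨y, hy, hxy⟩ := Metric.mem_thickening_iff.1 (hφs hx2.2)
    refine hgeo i x hx2.1 y hy (by rw [← dist_eq_norm]; exact hxy.le) _ ?_
    rw [mem_closedBall, dist_eq_norm] at hh
    have e : h + x - (x - ε • v i) = h - -(ε • v i) := by abel
    rw [e]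
    exact hh
  have hψ1 : ∀ x, ‖ψ x‖ ≤ 1 + Fintype.card ι * (L * ρ) := by
    intro x
    calc ‖ψ x‖ ≤ ∑ i, ‖vmol (η i) (w i) x‖ := norm_sum_le _ _
      _ ≤ ∑ i, (ζ i x + L * ρ) := by
          refine Finset.sum_le_sum fun i _ => vmol_norm hL (hηi i) (hη0 i) (hη1 i) (hηρ i) ?_
            (hζl i) x
          intro y
          rw [hw, norm_smul, Real.norm_of_nonneg (hζ0 i y)]
          exact mul_le_of_le_one_right (hζ0 i y) (hφ1 y)
      _ ≤ _ := by
          rw [Finset.sum_add_distrib]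
          simp only [Finset.sum_const, Finset.card_univ, nsmul_eq_mul]
          linarith [hζ1 x]
  have hmain : ∑ i, ∫ x, u i x * divg n (w i) x = ∫ x in E, divg n ψ x := by
    have h1 : ∀ i, ∫ x, u i x * divg n (w i) x = ∫ x in G, divg n (vmol (η i) (w i)) x := fun i =>
      mol_fubini (hη i).continuous (hηc i) hG hGf (hwC i) (hwc i)
    simp_rw [h1]
    rw [← integral_finsetSum]
    · simp_rw [hψ, divg_sum hψi]
      symm
      refine setIntegral_eq_of_subset_of_forall_sdiff_eq_zero hE inter_subset_left ?_
      intro x hx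
      rw [← divg_sum hψi]
      refine divg_zero_of_notMem fun hx' => ?_
      exact hx.2 ⟨hx.1, hψs hx'⟩
    · intro i _
      exact ((divg_cont (hψi i)).integrable_of_hasCompactSupport (divg_cpt (hψci i))).integrableOn
  refine (integral_congr_ae (ae_of_all _ hpt)).trans_le ?_
  have i3 : ∀ i ∈ (Finset.univ : Finset ι), Integrable fun x =>
      u i x * divg n (w i) x - (u i x - g x) * fderiv ℝ (ζ i) x (φ x) :=
    fun i _ => (i1 i).sub (i2 i)
  rw [integral_finsetSum _ i3]
  have h5 : ∀ i, ∫ x, (u i x * divg n (w i) x - (u i x - g x) * fderiv ℝ (ζ i) x (φ x)) ≤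
      (∫ x, u i x * divg n (w i) x) + L * τ := by
    intro i
    rw [integral_sub (i1 i) (i2 i)]
    linarith [b2 i]
  refine (Finset.sum_le_sum fun i _ => h5 i).trans ?_
  rw [Finset.sum_add_distrib, hmain]
  simp only [Finset.sum_const, Finset.card_univ, nsmul_eq_mul]
  have := per_scale hp (by positivity) hPer hψC hψc hψs hψ1
  linarith


lemma propA {n : ℕ} {E Ω : Set (Rn n)} (hE : MeasurableSet E) (hΩo : IsOpen Ω)
    (hΩb : Bornology.IsBounded Ω) (hlip : HasLipschitzBoundary n Ω) {p : ℝ} (hp : 0 ≤ p)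
    (hPer : Per n E Ω ≤ ENNReal.ofReal p) {δ : ℝ} (hδ : 0 < δ) :
    ∃ (f : Rn n → ℝ) (R : ℝ), ContDiff ℝ 2 f ∧ (∀ x, 0 ≤ f x) ∧ (∀ x, f x ≤ 1) ∧ 0 < R ∧
      ∫⁻ x in thickening R Ω, ENNReal.ofReal ‖gradient f x‖ ≤ ENNReal.ofReal (p + δ) ∧
      ∫⁻ x in Ω, ENNReal.ofReal |f x - E.indicator 1 x| ≤ ENNReal.ofReal δ ∧
      volume (thickening R Ω \ Ω) ≤ ENNReal.ofReal δ := by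
  obtain ⟨ι, _, ζ, v, c, ε0, R0, L, hc, hc1, hε0, hR0, hL, hv, hζ, hζ0, hζ1, hζs, hζL, hζl, hgeo⟩ :=
    pkg hΩo hΩb hlip
  set N : ℝ := (Fintype.card ι : ℝ) with hN
  have hN0 : 0 ≤ N := Nat.cast_nonneg _
  have hG : MeasurableSet (E ∩ Ω) := hE.inter hΩo.measurableSet
  have hGf : volume (E ∩ Ω) ≠ ⊤ := ne_top_of_le_ne_top hΩb.measure_lt_top.ne
    (measure_mono inter_subset_right)
  set τ : ℝ := δ / (2 * (N * L + N + 1)) with hτd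
  have hden : 0 < 2 * (N * L + N + 1) := by positivity
  have hτ : 0 < τ := div_pos hδ hden
  have hτe : 2 * (N * L + N + 1) * τ = δ := by rw [hτd]; field_simp
  have hNL : 0 ≤ N * L := by positivity
  obtain ⟨ρ0, hρ0, htr⟩ := translate_small hG hGf (ENNReal.ofReal_pos.2 hτ)
  -- choose ε
  obtain ⟨ε, hε, hε1, hε2, hε3, hε4⟩ : ∃ ε > (0:ℝ), ε < ε0 ∧ c * ε ≤ R0 ∧ 2 * ε ≤ ρ0 ∧
      N * (L * (2 * ε)) * p ≤ δ / 2 := by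
    have h : ∀ᶠ ε in 𝓝[>] (0:ℝ), ε < ε0 ∧ c * ε < R0 ∧ 2 * ε < ρ0 ∧
        N * (L * (2 * ε)) * p < δ / 2 := by
      refine Filter.Eventually.filter_mono nhdsWithin_le_nhds ?_
      refine Eventually.and (eventually_lt_nhds hε0) (Eventually.and ?_ (Eventually.and ?_ ?_))
      · exact ((by fun_prop : Continuous fun ε : ℝ => c * ε).tendsto 0).eventually_lt_const
          (by simpa using hR0)
      · exact ((by fun_prop : Continuous fun ε : ℝ => 2 * ε).tendsto 0).eventually_lt_const
          (by simpa using hρ0)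
      · exact ((by fun_prop : Continuous fun ε : ℝ => N * (L * (2 * ε)) * p).tendsto
          0).eventually_lt_const (by simpa using hδ)
    obtain ⟨ε, ⟨h1, h2, h3, h4⟩, h5⟩ := (h.and self_mem_nhdsWithin).exists
    exact ⟨ε, h5, h1, h2.le, h3.le, h4.le⟩
  have hcε : 0 < c * ε := mul_pos hc hε
  have hb := fun i => bump (-(ε • v i)) hcε
  choose η hη hηc hη0 hη1 hηs using hb
  have hηρ : ∀ i h, η i h ≠ 0 → ‖h‖ ≤ 2 * ε := by
    intro i h hh
    have h1 := hηs i hh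
    rw [mem_closedBall, dist_eq_norm] at h1
    have h2 : ‖ε • v i‖ ≤ ε := by
      rw [norm_smul, Real.norm_of_nonneg hε.le]
      exact mul_le_of_le_one_right hε.le (hv i)
    calc ‖h‖ = ‖(h - -(ε • v i)) - ε • v i‖ := by congr 1; abel
      _ ≤ ‖h - -(ε • v i)‖ + ‖ε • v i‖ := norm_sub_le _ _
      _ ≤ 2 * ε := by nlinarith
  set g : Rn n → ℝ := (E ∩ Ω).indicator 1 with hgd
  have hg : Measurable g := measurable_one.indicator hG
  have hg1 : ∀ x, ‖g x‖ ≤ 1 := by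
    intro x
    by_cases hx : x ∈ E ∩ Ω
    · rw [hgd, indicator_of_mem hx]; simp
    · rw [hgd, indicator_of_notMem hx]; simp
  have hg0 : ∀ x, 0 ≤ g x := fun x => indicator_nonneg (fun _ _ => zero_le_one) x
  have hgi : Integrable g := by
    rw [hgd, integrable_indicator_iff hG]
    exact integrableOn_const hGf
  have hL1 : ∀ i, ∫⁻ x, ENNReal.ofReal |mol (η i) g x - g x| ≤ ENNReal.ofReal τ := fun i =>
    mol_L1 (hη i).continuous (hηc i) (hη0 i) (hη1 i) hG (hηρ i)
      (fun h hh => htr h (hh.trans hε3))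
  have hu : ∀ i, ContDiff ℝ 2 (mol (η i) g) := fun i =>
    mol_contDiff (hη i) (hηc i) hgi.locallyIntegrable
  have hu0 : ∀ i x, 0 ≤ mol (η i) g x := fun i x => mol_nonneg (hη0 i) hg0 x
  have hu1 : ∀ i x, mol (η i) g x ≤ 1 := fun i x =>
    mol_le_one (hη i).continuous (hηc i) (hη0 i) (hη1 i) hg hg1 x
  set f : Rn n → ℝ := fun x => ∑ i, ζ i x * mol (η i) g x with hf
  have hfC : ContDiff ℝ 2 f := ContDiff.sum fun i _ => (hζ i).mul (hu i)
  -- choose R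
  obtain ⟨R, hR, hR1, hR2⟩ : ∃ R > (0:ℝ), R < c * ε ∧
      volume (thickening R Ω \ Ω) ≤ ENNReal.ofReal δ := by
    have hcl : volume (closure Ω) = volume Ω := by
      refine le_antisymm ?_ (measure_mono subset_closure)
      rw [closure_eq_self_union_frontier]
      exact (measure_union_le _ _).trans (by rw [aux_null hΩo hlip, add_zero])
    have ht := tendsto_measure_thickening (μ := (volume : Measure (Rn n))) (s := Ω)
      ⟨1, one_pos, hΩb.thickening.measure_lt_top.ne⟩
    rw [hcl] at ht
    have hlt : volume Ω < volume Ω + ENNReal.ofReal δ :=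
      ENNReal.lt_add_right hΩb.measure_lt_top.ne (ENNReal.ofReal_pos.2 hδ).ne'
    obtain ⟨R, ⟨h1, h2⟩, h3⟩ := (((ht.eventually_lt_const hlt).and
      (nhdsWithin_le_nhds (Iio_mem_nhds hcε))).and self_mem_nhdsWithin).exists
    refine ⟨R, h3, h2, ?_⟩
    rw [measure_sdiff (self_subset_thickening h3 Ω) hΩo.measurableSet.nullMeasurableSet
      hΩb.measure_lt_top.ne]
    exact tsub_le_iff_left.2 h1.le
  refine ⟨f, R, hfC, fun x => Finset.sum_nonneg fun i _ => mul_nonneg (hζ0 i x) (hu0 i x), ?_, hR,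
    ?_, ?_, hR2⟩
  · intro x
    refine le_trans (Finset.sum_le_sum fun i _ => ?_) (hζ1 x)
    exact mul_le_of_le_one_right (hζ0 i x) (hu1 i x)
  · refine (lintegral_mono_set (thickening_subset_cthickening R Ω)).trans ?_
    refine duality hfC (U := thickening (c * ε) Ω) isOpen_thickening
      (Metric.isCompact_of_isClosed_isBounded isClosed_cthickening hΩb.cthickening)
      (cthickening_subset_thickening' hcε hR1 Ω) ?_
    intro φ hφ hφc hφs hφ1
    have := approx_test hE hΩo hΩb hp hPer hc hε hL (ρ := 2 * ε) (by positivity) hε2 hτ.le hζ hζ0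
      hζ1 hζs hζL hζl (fun i => hgeo i ε hε hε1) hη hηc hη0 hη1 hηs hηρ hL1 hφ hφc hφs hφ1
    refine this.trans ?_
    nlinarith
  · calc ∫⁻ x in Ω, ENNReal.ofReal |f x - E.indicator 1 x|
        ≤ ∫⁻ x in Ω, ∑ i, ENNReal.ofReal |mol (η i) g x - g x| := by
          refine setLIntegral_mono' hΩo.measurableSet fun x hx => ?_
          have h1 : ∑ i, ζ i x = 1 := hζs x (self_subset_thickening hR0 Ω hx)
          have h2 : (E.indicator 1 x : ℝ) = g x := by
            rw [hgd]
            by_cases hxE : x ∈ E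
            · rw [indicator_of_mem hxE, indicator_of_mem (show x ∈ E ∩ Ω from ⟨hxE, hx⟩)]
            · rw [indicator_of_notMem hxE, indicator_of_notMem fun h => hxE h.1]
          have h3 : f x - g x = ∑ i, ζ i x * (mol (η i) g x - g x) := by
            simp_rw [mul_sub]
            rw [Finset.sum_sub_distrib, ← Finset.sum_mul, h1, one_mul]
          rw [h2, h3, ← ENNReal.ofReal_sum_of_nonneg fun i _ => abs_nonneg _]
          refine ENNReal.ofReal_le_ofReal ((Finset.abs_sum_le_sum_abs _ _).trans
            (Finset.sum_le_sum fun i _ => ?_))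
          rw [abs_mul, abs_of_nonneg (hζ0 i x)]
          refine mul_le_of_le_one_left (abs_nonneg _) ?_
          rw [← h1]
          exact Finset.single_le_sum (f := fun j => ζ j x) (fun j _ => hζ0 j x) (Finset.mem_univ i)
      _ ≤ ∫⁻ x, ∑ i, ENNReal.ofReal |mol (η i) g x - g x| := setLIntegral_le_lintegral _ _
      _ = ∑ i, ∫⁻ x, ENNReal.ofReal |mol (η i) g x - g x| :=
          lintegral_finsetSum _ fun i _ =>
            ((hu i).continuous.measurable.sub hg).abs.ennreal_ofReal
      _ ≤ ∑ i : ι, ENNReal.ofReal τ := Finset.sum_le_sum fun i _ => hL1 i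
      _ = ENNReal.ofReal (N * τ) := by
          rw [Finset.sum_const, Finset.card_univ, nsmul_eq_mul, hN,
            ENNReal.ofReal_mul (Nat.cast_nonneg _), ENNReal.ofReal_natCast]
      _ ≤ ENNReal.ofReal δ := by
          refine ENNReal.ofReal_le_ofReal ?_
          nlinarith [mul_nonneg hNL hτ.le, mul_nonneg hN0 hτ.le]


lemma propB {n : ℕ} (hn : 1 ≤ n) {E Ω : Set (Rn n)} (hE : MeasurableSet E) (hΩo : IsOpen Ω)
    (hΩb : Bornology.IsBounded Ω) {f : Rn n → ℝ} {R δ A : ℝ} (hδ : 0 ≤ δ) (hA : 0 ≤ A) (hR : 0 < R)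
    (hf : ContDiff ℝ 2 f) (hf0 : ∀ x, 0 ≤ f x) (hf1 : ∀ x, f x ≤ 1)
    (hgr : ∫⁻ x in thickening R Ω, ENNReal.ofReal ‖gradient f x‖ ≤ ENNReal.ofReal A)
    (hL : ∫⁻ x in Ω, ENNReal.ofReal |f x - E.indicator 1 x| ≤ ENNReal.ofReal δ)
    (hvol : volume (thickening R Ω \ Ω) ≤ ENNReal.ofReal δ) {s : ℝ} (hs0 : 0 < s) (hs : s < 1/2) :
    ∃ F : Set (Rn n), MeasurableSet F ∧ volume (symmDiff F E) ≤ ENNReal.ofReal (16 * δ) ∧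
      ENNReal.ofReal (1/2 - s) * PerS n s F Ω ≤ ENNReal.ofReal
        (4/3 * (√n * bvol n * (R/2)^(1-2*s) / 4 * A + (1/2 - s) * (2 * (volume Ω).toReal *
          (n * bvol n * ((R/2)^(-(2*s)) / (2*s)))))) := by
  classical
  set U := thickening R Ω with hU
  have hUm : MeasurableSet U := isOpen_thickening.measurableSet
  have hΩU : Ω ⊆ U := self_subset_thickening hR Ω
  set χ : Rn n → ℝ := E.indicator 1 with hχ
  have hχm : Measurable χ := measurable_one.indicator hE
  have hχ0 : ∀ x, 0 ≤ χ x := fun x => indicator_nonneg (fun _ _ => zero_le_one) x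
  have hχ1 : ∀ x, χ x ≤ 1 := fun x => indicator_le_self' (fun _ _ => zero_le_one) x
  set v : Rn n → ℝ := U.piecewise f χ with hv
  have hvm : Measurable v := Measurable.piecewise hUm hf.continuous.measurable hχm
  have hvU : ∀ x ∈ U, v x = f x := fun x hx => piecewise_eq_of_mem _ _ _ hx
  have hvU' : ∀ x, x ∉ U → v x = χ x := fun x hx => piecewise_eq_of_notMem _ _ _ hx
  have hv0 : ∀ x, 0 ≤ v x := fun x => by
    by_cases hx : x ∈ U
    · rw [hvU x hx]; exact hf0 x
    · rw [hvU' x hx]; exact hχ0 x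
  have hv1 : ∀ x, v x ≤ 1 := fun x => by
    by_cases hx : x ∈ U
    · rw [hvU x hx]; exact hf1 x
    · rw [hvU' x hx]; exact hχ1 x
  obtain ⟨t, ht, hF⟩ := coarea_choice s hΩo hvm
  have hJ := Jfun_bound hn hs0 hs (half_pos hR) hΩo (hf.of_le (by norm_num)) hvm hv0 hv1
    (by rw [mul_div_cancel₀ R two_ne_zero]; exact hvU)
  rw [mul_div_cancel₀ R two_ne_zero] at hJ
  refine ⟨{x | t < v x}, measurableSet_lt measurable_const hvm, ?_, ?_⟩
  · have h1 : ∫⁻ x, ENNReal.ofReal |v x - χ x| ≤ ENNReal.ofReal (2 * δ) := by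
      calc ∫⁻ x, ENNReal.ofReal |v x - χ x|
          ≤ ∫⁻ x in U, ENNReal.ofReal |v x - χ x| := by
            rw [← lintegral_indicator hUm]
            refine lintegral_mono fun x => ?_
            by_cases hx : x ∈ U
            · rw [indicator_of_mem hx]
            · rw [hvU' x hx]; simp
        _ = (∫⁻ x in Ω, ENNReal.ofReal |v x - χ x|)
            + ∫⁻ x in U \ Ω, ENNReal.ofReal |v x - χ x| := by
            rw [← lintegral_union (hUm.diff hΩo.measurableSet) disjoint_sdiff_right,
              union_sdiff_cancel hΩU]
        _ ≤ ENNReal.ofReal δ + ENNReal.ofReal δ := by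
            refine add_le_add ?_ ?_
            · refine le_trans (le_of_eq ?_) hL
              refine setLIntegral_congr_fun hΩo.measurableSet fun x hx => ?_
              simp only [hvU x (hΩU hx)]
            · refine le_trans ?_ hvol
              calc ∫⁻ x in U \ Ω, ENNReal.ofReal |v x - χ x| ≤ ∫⁻ x in U \ Ω, 1 := by
                    refine lintegral_mono fun x => ?_
                    rw [ENNReal.ofReal_le_one, abs_le]
                    constructor <;> linarith [hv0 x, hv1 x, hχ0 x, hχ1 x]
                _ = _ := by simp
        _ = ENNReal.ofReal (2 * δ) := by rw [← ENNReal.ofReal_add hδ hδ, two_mul]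
    have h2 := mul_meas_ge_le_lintegral (μ := (volume : Measure (Rn n)))
      (f := fun x => ENNReal.ofReal |v x - χ x|) (hvm.sub hχm).abs.ennreal_ofReal
      (ENNReal.ofReal (1/8))
    have h3 : symmDiff {x | t < v x} E ⊆
        {x | ENNReal.ofReal (1/8) ≤ ENNReal.ofReal |v x - χ x|} := by
      intro x hx
      refine ENNReal.ofReal_le_ofReal ?_
      rcases hx with ⟨hx1, hx2⟩ | ⟨hx1, hx2⟩
      · have h4 : χ x = 0 := indicator_of_notMem hx2 _
        have h5 : t < v x := hx1
        rw [h4, sub_zero]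
        exact le_trans (by linarith [ht.1]) (le_abs_self _)
      · have h4 : χ x = 1 := indicator_of_mem hx1 _
        have h5 : v x ≤ t := not_lt.1 hx2
        rw [h4, abs_sub_comm]
        exact le_trans (by linarith [ht.2]) (le_abs_self _)
    calc volume (symmDiff {x | t < v x} E)
        = ENNReal.ofReal 8 * (ENNReal.ofReal (1/8) * volume (symmDiff {x | t < v x} E)) := by
          rw [← mul_assoc, ← ENNReal.ofReal_mul (by norm_num)]; norm_num
      _ ≤ ENNReal.ofReal 8 * ENNReal.ofReal (2 * δ) := by
          gcongr
          exact (mul_le_mul_right (measure_mono h3) _).trans (h2.trans h1)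
      _ = ENNReal.ofReal (16 * δ) := by
          rw [← ENNReal.ofReal_mul (by norm_num)]; ring_nf
  · have hs2 : 0 < 1/2 - s := by linarith
    have hb := (bvol_pos n).le
    have hr : 0 < R / 2 := half_pos hR
    have hVe : volume Ω = ENNReal.ofReal (volume Ω).toReal :=
      (ENNReal.ofReal_toReal hΩb.measure_lt_top.ne).symm
    have hr1 : 0 ≤ (R/2)^(1-2*s) := Real.rpow_nonneg hr.le _
    have hr2 : 0 ≤ (R/2)^(-(2*s)) / (2*s) := div_nonneg (Real.rpow_nonneg hr.le _) (by linarith)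
    have hc1 : 0 ≤ √n * bvol n * (R/2)^(1-2*s) / (2*(1-2*s)) :=
      div_nonneg (by positivity) (by linarith)
    have hV0 : 0 ≤ (volume Ω).toReal := ENNReal.toReal_nonneg
    calc ENNReal.ofReal (1/2 - s) * PerS n s {x | t < v x} Ω
        ≤ ENNReal.ofReal (1/2 - s) * (ENNReal.ofReal (4/3) *
          (ENNReal.ofReal (√n * bvol n * (R/2)^(1-2*s) / (2*(1-2*s))) * ENNReal.ofReal A +
           2 * volume Ω * ENNReal.ofReal (n * bvol n * ((R/2)^(-(2*s)) / (2*s))))) := by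
          gcongr
          refine hF.trans ?_
          gcongr
          refine hJ.trans ?_
          gcongr
      _ = ENNReal.ofReal ((1/2 - s) * (4/3 *
          (√n * bvol n * (R/2)^(1-2*s) / (2*(1-2*s)) * A +
           2 * (volume Ω).toReal * (n * bvol n * ((R/2)^(-(2*s)) / (2*s)))))) := by
          rw [ENNReal.ofReal_mul hs2.le, ENNReal.ofReal_mul (by norm_num : (0:ℝ) ≤ 4/3),
            ENNReal.ofReal_add (mul_nonneg hc1 hA) (by positivity), ENNReal.ofReal_mul hc1,
            ENNReal.ofReal_mul (by positivity : 0 ≤ 2 * (volume Ω).toReal),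
            ENNReal.ofReal_mul (by norm_num : (0:ℝ) ≤ 2), ← hVe]
          norm_num
      _ = _ := by
          congr 1
          have : (1 - 2 * s) ≠ 0 := by linarith
          field_simp
          ring

lemma propC {n : ℕ} (hn : 1 ≤ n) {E Ω : Set (Rn n)} (hE : MeasurableSet E) (hΩo : IsOpen Ω)
    (hΩb : Bornology.IsBounded Ω) (hlip : HasLipschitzBoundary n Ω) (hPer : Per n E Ω ≠ ⊤)
    {si : ℕ → ℝ} (hsi : ∀ i, si i ∈ Set.Ioo (0:ℝ) (1/2))
    (hs : Tendsto si atTop (𝓝 (1/2 : ℝ))) {δ : ℝ} (hδ : 0 < δ) :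
    ∀ᶠ i in atTop, ∃ F : Set (Rn n), MeasurableSet F ∧ volume (symmDiff F E) ≤ ENNReal.ofReal δ ∧
      ENNReal.ofReal (1/2 - si i) * PerS n (si i) F Ω ≤
        omegaBall (n - 1) * Per n E Ω + ENNReal.ofReal δ := by
  set p := (Per n E Ω).toReal with hp
  have hpe : Per n E Ω = ENNReal.ofReal p := (ENNReal.ofReal_toReal hPer).symm
  have hp0 : 0 ≤ p := ENNReal.toReal_nonneg
  set B := bvol (n - 1) with hB
  have hB0 : 0 < B := bvol_pos _
  obtain ⟨d, hd, hd1, hd2⟩ : ∃ d > (0:ℝ), 16 * d ≤ δ ∧ B * d ≤ δ / 2 := by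
    refine ⟨min (δ / 16) (δ / (2 * B)), by positivity, ?_, ?_⟩
    · linarith [min_le_left (δ / 16) (δ / (2 * B))]
    · calc B * min (δ / 16) (δ / (2 * B)) ≤ B * (δ / (2 * B)) := by
            gcongr; exact min_le_right _ _
        _ = δ / 2 := by field_simp
  obtain ⟨f, R, hf, hf0, hf1, hR, hgr, hL, hvol⟩ := propA hE hΩo hΩb hlip hp0 hpe.le hd
  have hr : 0 < R / 2 := half_pos hR
  set H : ℝ → ℝ := fun s => 4/3 * (√n * bvol n * (R/2)^(1-2*s) / 4 * (p + d) + (1/2 - s) *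
    (2 * (volume Ω).toReal * (n * bvol n * ((R/2)^(-(2*s)) / (2*s))))) with hH
  have hHc : ContinuousAt H (1/2) := by
    have e1 : ContinuousAt (fun s : ℝ => (R/2)^(1-2*s)) (1/2) :=
      ContinuousAt.rpow continuousAt_const (by fun_prop) (Or.inl hr.ne')
    have e2 : ContinuousAt (fun s : ℝ => (R/2)^(-(2*s))) (1/2) :=
      ContinuousAt.rpow continuousAt_const (by fun_prop) (Or.inl hr.ne')
    have e3 : ContinuousAt (fun s : ℝ => (R/2)^(-(2*s)) / (2*s)) (1/2) :=
      e2.div (by fun_prop) (by norm_num)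
    rw [hH]
    fun_prop
  have hH1 : H (1/2) < B * p + δ := by
    have h1 : H (1/2) = √n * bvol n / 3 * (p + d) := by
      simp only [hH]; norm_num; ring
    rw [h1]
    have := mul_le_mul_of_nonneg_right (omega_ratio n hn) (by linarith : 0 ≤ p + d)
    linarith
  filter_upwards [(hHc.tendsto.comp hs).eventually_lt_const hH1] with i hi
  obtain ⟨F, hF, h1, h2⟩ := propB hn hE hΩo hΩb hd.le (by linarith : 0 ≤ p + d) hR hf hf0 hf1 hgr hL
    hvol (hsi i).1 (hsi i).2
  refine ⟨F, hF, h1.trans (ENNReal.ofReal_le_ofReal hd1), h2.trans ?_⟩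
  rw [omega_eq, hpe, ← ENNReal.ofReal_mul hB0.le, ← ENNReal.ofReal_add (by positivity) hδ.le]
  exact ENNReal.ofReal_le_ofReal hi.le


lemma diag_choice {α : Type*} [Nonempty α] (q : ℕ → α → ℝ≥0∞)
    (h : ∀ δ : ℝ, 0 < δ → ∀ᶠ i in atTop, ∃ F, q i F ≤ ENNReal.ofReal δ) :
    ∃ F : ℕ → α, Tendsto (fun i => q i (F i)) atTop (𝓝 0) := by
  have h1 : ∀ i, ∃ F, q i F ≤ (⨅ G, q i G) + ((i : ℝ≥0∞) + 1)⁻¹ := by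
    intro i
    by_cases ht : (⨅ G, q i G) = ⊤
    · exact ⟨Classical.arbitrary α, by rw [ht, top_add]; exact le_top⟩
    · have h2 : (⨅ G, q i G) < (⨅ G, q i G) + ((i : ℝ≥0∞) + 1)⁻¹ :=
        ENNReal.lt_add_right ht (ENNReal.inv_ne_zero.2 (by finiteness))
      obtain ⟨F, hF⟩ := iInf_lt_iff.1 h2
      exact ⟨F, hF.le⟩
  choose F hF using h1
  refine ⟨F, ?_⟩
  have hm : Tendsto (fun i => ⨅ G, q i G) atTop (𝓝 0) := by
    rw [ENNReal.tendsto_nhds_zero]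
    intro ε hε
    by_cases hεt : ε = ⊤
    · exact Eventually.of_forall fun i => hεt ▸ le_top
    · filter_upwards [h ε.toReal (ENNReal.toReal_pos hε.ne' hεt)] with i hi
      obtain ⟨G, hG⟩ := hi
      rw [ENNReal.ofReal_toReal hεt] at hG
      exact (iInf_le _ G).trans hG
  have hi : Tendsto (fun i : ℕ => ((i : ℝ≥0∞) + 1)⁻¹) atTop (𝓝 0) := by
    have := (tendsto_add_atTop_iff_nat 1).2 ENNReal.tendsto_inv_nat_nhds_zero
    simpa using this
  have hsum := hm.add hi
  rw [add_zero] at hsum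
  exact tendsto_of_tendsto_of_tendsto_of_le_of_le tendsto_const_nhds hsum (fun _ => zero_le) hF

/-- **Ambrosio–De Philippis–Martinazzi, limsup inequality.**
For every measurable `E ⊂ ℝⁿ`, every bounded open `Ω` with Lipschitz boundary and every
sequence `s_i → (1/2)⁻`, there is a sequence of measurable sets `E_i` with
`χ_{E_i} → χ_E` in `L¹_loc(ℝⁿ)` such that
`limsup_i (1/2 − s_i) Per_{s_i}(E_i,Ω) ≤ ω_{n−1} Per(E,Ω)`. -/
theorem adm_limsup
    (n : ℕ) (hn : 1 ≤ n) (E : Set (Rn n)) (hE : MeasurableSet E)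
    (Ω : Set (Rn n)) (hΩo : IsOpen Ω) (hΩb : Bornology.IsBounded Ω)
    (hΩlip : HasLipschitzBoundary n Ω)
    (si : ℕ → ℝ) (hsi : ∀ i, si i ∈ Set.Ioo (0:ℝ) (1/2))
    (hs : Tendsto si atTop (𝓝 (1/2 : ℝ))) :
    ∃ Ei : ℕ → Set (Rn n), (∀ i, MeasurableSet (Ei i)) ∧
      (∀ K : Set (Rn n), IsCompact K →
        Tendsto (fun i => volume (symmDiff (Ei i) E ∩ K)) atTop (𝓝 0)) ∧
      limsup (fun i => ENNReal.ofReal (1/2 - si i) * PerS n (si i) (Ei i) Ω) atTop ≤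
        omegaBall (n - 1) * Per n E Ω := by
  by_cases hPer : Per n E Ω = ⊤
  · refine ⟨fun _ => E, fun _ => hE, fun K _ => by simp, ?_⟩
    rw [hPer, ENNReal.mul_top]
    · exact le_top
    · rw [omega_eq]
      exact (ENNReal.ofReal_pos.2 (bvol_pos _)).ne'
  · set L := omegaBall (n - 1) * Per n E Ω with hL
    have : Nonempty {F : Set (Rn n) // MeasurableSet F} := ⟨⟨E, hE⟩⟩
    obtain ⟨F, hF⟩ := diag_choice (α := {F : Set (Rn n) // MeasurableSet F})
      (fun i F => max (volume (symmDiff F.1 E))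
        (ENNReal.ofReal (1/2 - si i) * PerS n (si i) F.1 Ω - L)) (by
        intro δ hδ
        filter_upwards [propC hn hE hΩo hΩb hΩlip hPer hsi hs hδ] with i hi
        obtain ⟨F, h1, h2, h3⟩ := hi
        exact ⟨⟨F, h1⟩, max_le h2 (tsub_le_iff_left.2 h3)⟩)
    refine ⟨fun i => (F i).1, fun i => (F i).2, fun K _ => ?_, ?_⟩
    · exact tendsto_of_tendsto_of_tendsto_of_le_of_le tendsto_const_nhds hF (fun _ => zero_le)
        fun i => (measure_mono inter_subset_left).trans (le_max_left _ _)
    · have h1 := hF.const_add L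
      rw [add_zero] at h1
      rw [← h1.limsup_eq]
      refine limsup_le_limsup (Eventually.of_forall fun i => ?_)
      exact tsub_le_iff_left.1 (le_max_right _ _)

end
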